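/- arXiv:math/9710216 — 2 statements merged into one kernel-verified Lean document; each statement's English description precedes it below -/
import Mathlib

section
/- Chain condition: for κ ∈ K and p ∈ Q, the suborder Q^{apr}_{κ,p} = {q ∈ Q : p ≤^{apr}_κ q}, ordered by ≤^{apr}_κ, satisfies the (2^{<θ_κ})⁺-chain condition: any family of (2^{<θ_κ})⁺ many conditions in Q^{apr}_{κ,p} contains two that are compatible in Q (equivalently, in Q^{apr}_{κ,p}). -/
open Cardinal Set

noncomputable section

attribute [local instance] Classical.propDecidable

/-- A forcing condition: a partial `{0,1}`-valued function on ordinals,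
coded as an `Option Bool`-valued function. -/
abbrev Cond : Type 1 := Ordinal → Option Bool

/-- The domain of a condition. -/
def cdom (q : Cond) : Set Ordinal := {i | (q i).isSome}

/-- The `E_κ`-equivalence class of `i` : `j E_κ i` iff `j + κ = i + κ` (ordinal addition). -/
def Ecl (κ : Cardinal) (i : Ordinal) : Set Ordinal := {j | j + κ.ord = i + κ.ord}

/-- The `E_{<κ}`-class of `i`, where `E_{<κ} = id ∪ ⋃ {E_θ : θ ∈ K ∩ κ}`. -/
def EclLt (K : Set Cardinal) (κ : Cardinal) (i : Ordinal) : Set Ordinal :=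
  {i} ∪ ⋃ θ ∈ K ∩ Set.Iio κ, Ecl θ i

/-- `θ_κ` : the least regular cardinal `≥ sup((K ∩ κ) ∪ {λ})`. -/
def theta (lam : Cardinal) (K : Set Cardinal) (κ : Cardinal) : Cardinal :=
  sInf {θ : Cardinal | θ.IsRegular ∧ sSup ((K ∩ Set.Iio κ) ∪ {lam}) ≤ θ}

/-- `A` grows from `X` to `Y` : `∅ ≠ A ∩ X ≠ A ∩ Y`. -/
def grows (A X Y : Set Ordinal) : Prop := (A ∩ X).Nonempty ∧ A ∩ X ≠ A ∩ Y

/-- Membership in the forcing `Q = Q_K`. -/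
def inQ (lam mu : Cardinal) (K : Set Cardinal) (q : Cond) : Prop :=
  cdom q ⊆ Set.Iio mu.ord ∧
    ∀ i < mu.ord, ∀ κ ∈ K, #↥(Ecl κ i ∩ cdom q) < Cardinal.lift.{1} (theta lam K κ)

/-- The set of `E_κ`-classes which grow from `X` to `Y`. -/
def growClasses (mu : Cardinal) (κ : Cardinal) (X Y : Set Ordinal) : Set (Set Ordinal) :=
  {A | (∃ i < mu.ord, A = Ecl κ i) ∧ grows A X Y}

/-- The forcing order: `p ⊆ q` and for each `κ ∈ K`, fewer than `θ_κ` many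
`E_κ`-classes grow from `dom p` to `dom q`. -/
def condLe (lam mu : Cardinal) (K : Set Cardinal) (p q : Cond) : Prop :=
  (∀ i b, p i = some b → q i = some b) ∧
    ∀ κ ∈ K, #↥(growClasses mu κ (cdom p) (cdom q)) < Cardinal.lift.{1} (theta lam K κ)

/-- Pure extension at `κ`: no `E_κ`-class represented in `dom p` grows. -/
def condLePr (lam mu : Cardinal) (K : Set Cardinal) (κ : Cardinal) (p q : Cond) : Prop :=
  condLe lam mu K p q ∧ ∀ i : Ordinal, ¬ grows (Ecl κ i) (cdom p) (cdom q)

/-- Apure extension at `κ`: no new `E_κ`-classes are represented in `dom q`. -/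
def condLeApr (lam mu : Cardinal) (K : Set Cardinal) (κ : Cardinal) (p q : Cond) : Prop :=
  condLe lam mu K p q ∧ ∀ i ∈ cdom q, (Ecl κ i ∩ cdom p).Nonempty

/-- Union of two conditions (as partial functions, left priority). -/
def unionC (p q : Cond) : Cond := fun i => (p i).orElse (fun _ => q i)

/-- Restriction of a condition to a set of ordinals. -/
def restrictC (q : Cond) (X : Set Ordinal) : Cond := fun ξ => if ξ ∈ X then q ξ else none

/-- Union of a family of conditions indexed by ordinals below `θo`. -/
def unionFam (f : Ordinal → Cond) (θo : Ordinal) : Cond :=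
  fun ξ => if h : ∃ i, i < θo ∧ (f i ξ).isSome then f h.choose ξ else none

/-- Compatibility in `Q`: existence of a common upper bound in `Q`. -/
def compatQ (lam mu : Cardinal) (K : Set Cardinal) (q₁ q₂ : Cond) : Prop :=
  ∃ r : Cond, inQ lam mu K r ∧ condLe lam mu K q₁ r ∧ condLe lam mu K q₂ r

/-- Standing ground-model hypotheses: `λ = λ^{<λ}` regular, `μ = μ^λ` regular,
`K ⊆ [λ, μ]` a set of regular cardinals with `λ, μ ∈ K`. -/
def GroundCtx (lam mu : Cardinal) (K : Set Cardinal) : Prop :=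
  lam.IsRegular ∧ lam ^< lam = lam ∧ mu.IsRegular ∧ mu ^ lam = mu ∧
    (∀ κ ∈ K, κ.IsRegular ∧ lam ≤ κ ∧ κ ≤ mu) ∧ lam ∈ K ∧ mu ∈ K

universe u

lemma regType (Θ : Cardinal.{u}) (h : Θ.IsRegular) :
    ∃ (W : Type u) (_ : LinearOrder W) (_ : WellFoundedLT W), #W = Θ ∧
      (∀ a : W, #(Iio a) < Θ) ∧ ∀ s : Set W, #s < Θ → ∃ a, ∀ x ∈ s, x < a := by
  refine ⟨Θ.ord.ToType, inferInstance, inferInstance, by simp, ?_, ?_⟩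
  · intro a
    exact mk_Iio_toType_ord_lt a
  · intro s hs
    by_contra hcon
    push Not at hcon
    have : IsCofinal s := hcon
    have h2 := Order.cof_le this
    rw [Ordinal.cof_toType, h.cof_ord] at h2
    exact absurd hs (not_lt.2 h2)

lemma le_two_powerlt (Θ : Cardinal.{u}) : Θ ≤ 2 ^< Θ := by
  by_contra! hlt
  have h1 := le_powerlt 2 hlt
  exact absurd (cantor _) (not_lt.2 h1)

lemma powerlt_pow (Θ : Cardinal.{u}) (h : Θ.IsRegular) (c : Cardinal.{u}) (hc : c < Θ) :
    (2 ^< Θ) ^ c ≤ 2 ^< Θ := by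
  classical
  obtain ⟨W, _, _, hW, hI, hb⟩ := regType Θ h
  have hge : ∀ c < Θ, ∃ a : W, c ≤ #(Iio a) := by
    intro c hc
    rw [← hW] at hc
    obtain ⟨s, hs⟩ := le_mk_iff_exists_set.1 hc.le
    obtain ⟨a, ha⟩ := hb s (by rw [hs, ← hW]; exact hc)
    exact ⟨a, by rw [← hs]; exact mk_le_mk_of_subset ha⟩
  let T : Type u := {s : Set W // ∃ a, ∀ x ∈ s, x < a}
  have hT : 2 ^< Θ ≤ #T := by
    rw [powerlt_le]
    intro d hd
    obtain ⟨a, ha⟩ := hge d hd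
    refine (power_le_power_left two_ne_zero ha).trans ?_
    rw [← mk_set]
    refine mk_le_of_injective (f := fun s : Set (Iio a) =>
      (⟨Subtype.val '' s, a, by rintro _ ⟨x, _, rfl⟩; exact x.2⟩ : T)) ?_
    intro s t hst
    exact Subtype.val_injective.image_injective (congrArg Subtype.val hst)
  induction c using Cardinal.inductionOn with | _ C =>
  refine (power_le_power_right hT).trans ?_
  rw [power_def]
  have hbd : ∀ f : C → T, ∃ a : W, ∀ c, ∀ x ∈ (f c).1, x < a := by
    intro f
    choose b hbb using fun c => (f c).2
    obtain ⟨a, ha⟩ := hb (range b) (mk_range_le.trans_lt hc)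
    exact ⟨a, fun c x hx => (hbb c x hx).trans (ha _ ⟨c, rfl⟩)⟩
  choose A hA using hbd
  have h1 : #(C → T) ≤ #(Σ a : W, (C → Set (Iio a))) := by
    refine mk_le_of_injective (f := fun f => ⟨A f, fun c => Subtype.val ⁻¹' (f c).1⟩) ?_
    intro f g hfg
    simp only [Sigma.mk.injEq] at hfg
    obtain ⟨h1, h2⟩ := hfg
    have h3 : ∀ (a : W), a = A g → (∀ c, ∀ x ∈ (f c).1, x < a) →
        (HEq (fun c => (Subtype.val ⁻¹' (f c).1 : Set (Iio a)))
          (fun c => (Subtype.val ⁻¹' (g c).1 : Set (Iio (A g))))) → f = g := by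
      rintro a rfl hf hh
      have hh := eq_of_heq hh
      funext c
      have := congrFun hh c
      apply Subtype.ext
      ext x
      constructor
      · intro hx
        have : (⟨x, hf c x hx⟩ : Iio (A g)) ∈ (Subtype.val ⁻¹' (f c).1 : Set (Iio (A g))) := hx
        rw [congrFun hh c] at this
        exact this
      · intro hx
        have : (⟨x, hA g c x hx⟩ : Iio (A g)) ∈ (Subtype.val ⁻¹' (g c).1 : Set (Iio (A g))) := hx
        rw [← congrFun hh c] at this
        exact this
    exact h3 (A f) h1 (hA f) h2
  refine h1.trans ?_
  rw [mk_sigma]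
  have h0 : ℵ₀ ≤ 2 ^< Θ := h.aleph0_le.trans (le_two_powerlt Θ)
  refine (sum_le_sum _ (fun _ => 2 ^< Θ) ?_).trans ?_
  · intro a
    rw [← power_def, mk_set, ← power_mul]
    exact le_powerlt 2 (mul_lt_of_lt h.aleph0_le (hI a) hc)
  · rw [sum_const', hW]
    exact mul_le_of_le h0 (le_two_powerlt Θ) le_rfl

/-- number of small subsets -/
lemma small_subsets {Y : Type u} (Θ χ : Cardinal.{u}) (h : Θ.IsRegular) (hχ : Θ ≤ χ)
    (hpow : ∀ c < Θ, χ ^ c ≤ χ) (hY : #Y ≤ χ) : #{s : Set Y // #s < Θ} ≤ χ := by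
  classical
  obtain ⟨W, _, _, hW, hI, hb⟩ := regType Θ h
  have h0 : ℵ₀ ≤ χ := h.aleph0_le.trans hχ
  have hsur : ∀ s : {s : Set Y // #s < Θ}, ∃ q : Σ a : W, (Iio a → Option Y),
      s.1 = {y | ∃ x, q.2 x = some y} := by
    rintro ⟨s, hs⟩
    have hs' := hs
    rw [← hW] at hs'
    obtain ⟨t, ht⟩ := le_mk_iff_exists_set.1 hs'.le
    obtain ⟨a, ha⟩ := hb t (by rw [ht]; exact hs)
    obtain ⟨e⟩ := Cardinal.eq.1 ht
    refine ⟨⟨a, fun x => if hx : x.1 ∈ t then some (e ⟨x.1, hx⟩).1 else none⟩, ?_⟩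
    ext y
    constructor
    · intro hy
      refine ⟨⟨(e.symm ⟨y, hy⟩).1, ha _ (e.symm ⟨y, hy⟩).2⟩, ?_⟩
      simp
    · rintro ⟨x, hx⟩
      dsimp only at hx
      split_ifs at hx with hxt
      rw [← Option.some.inj hx]
      exact (e _).2
  choose q hq using hsur
  have hinj : Function.Injective q := by
    intro s t hst
    apply Subtype.ext
    rw [hq s, hq t, hst]
  refine (mk_le_of_injective hinj).trans ?_
  rw [mk_sigma]
  refine (sum_le_sum _ (fun _ => χ) ?_).trans ?_
  · intro a
    rw [← power_def]
    refine le_trans (power_le_power_right ?_) (hpow _ (hI a))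
    rw [mk_option]
    exact add_le_of_le h0 hY (one_le_aleph0.trans h0)
  · rw [sum_const', hW]
    exact mul_le_of_le h0 hχ le_rfl

lemma union_le {α ι : Type u} (χ : Cardinal.{u}) (h0 : ℵ₀ ≤ χ) (t : ι → Set α) (hι : #ι ≤ χ)
    (ht : ∀ i, #(t i) ≤ χ) : #(⋃ i, t i) ≤ χ := by
  refine mk_iUnion_le_sum_mk.trans ((sum_le_sum _ (fun _ => χ) ht).trans ?_)
  rw [sum_const']
  exact mul_le_of_le h0 hι le_rfl

lemma core {ι X : Type u} (Θ χ : Cardinal.{u}) (h : Θ.IsRegular) (hχ : Θ ≤ χ)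
    (hpow : ∀ c < Θ, χ ^ c ≤ χ) (E : X → X → Prop) (hE : Equivalence E)
    (hEc : ∀ x, #{y | E x y} ≤ χ) (g : ι → X → Option Bool)
    (hD : ∀ i, #{x | (g i x).isSome} < Θ) (hι : χ < #ι) :
    ∃ i j, i ≠ j ∧ ∀ x y, (g i x).isSome → (g j y).isSome → E x y →
      ∀ z, E x z → g i z = g j z := by
  classical
  have h0 : ℵ₀ ≤ χ := h.aleph0_le.trans hχ
  obtain ⟨W, _, _, hW, hI, hb⟩ := regType Θ h
  have hpick : ∀ S : Set X, ∃ P : Set ι, #S ≤ χ →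
      (#P ≤ χ ∧ ∀ j, ∃ i ∈ P, ∀ x ∈ S, g i x = g j x) := by
    intro S
    by_cases hS : #S ≤ χ
    swap
    · exact ⟨∅, fun h => absurd h hS⟩
    have hsm : ∀ i, #({q : S × Bool | g i q.1 = some q.2} : Set (S × Bool)) < Θ := by
      intro i
      refine lt_of_le_of_lt ?_ (hD i)
      refine mk_le_of_injective (f := fun q => ⟨q.1.1.1, ?_⟩) ?_
      · have := q.2
        simp only [mem_ofPred_eq] at this ⊢
        rw [this]; rfl
      · rintro ⟨⟨⟨x, hx⟩, b⟩, hq⟩ ⟨⟨⟨y, hy⟩, c⟩, hq'⟩ hxy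
        simp only [mem_ofPred_eq] at hq hq'
        simp only [Subtype.mk.injEq] at hxy
        subst hxy
        rw [hq] at hq'
        cases hq'
        rfl
    let r : ι → {s : Set (S × Bool) // #s < Θ} := fun i => ⟨_, hsm i⟩
    have hSB : #(S × Bool) ≤ χ := by
      rw [mk_prod]
      simp only [lift_id, lift_uzero]
      refine mul_le_of_le h0 hS ?_
      simpa using (natCast_lt_aleph0 (n := 2)).le.trans h0
    let sec : range r → ι := fun v => v.2.choose
    have hsec : ∀ v, r (sec v) = v := fun v => v.2.choose_spec
    refine ⟨range sec, fun _ => ⟨?_, ?_⟩⟩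
    · exact mk_range_le.trans ((mk_set_le _).trans (small_subsets Θ χ h hχ hpow hSB))
    · intro j
      refine ⟨sec ⟨r j, j, rfl⟩, ⟨_, rfl⟩, ?_⟩
      intro x hx
      have := congrArg Subtype.val (hsec ⟨r j, j, rfl⟩)
      have key : ∀ b, g (sec ⟨r j, j, rfl⟩) x = some b ↔ g j x = some b := by
        intro b
        exact Set.ext_iff.1 this (⟨x, hx⟩, b)
      exact Option.ext key
  let P : Set X → Set ι := fun S => (hpick S).choose
  have hPc : ∀ S : Set X, #S ≤ χ → #(P S) ≤ χ := fun S hS => ((hpick S).choose_spec hS).1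
  have hP : ∀ S : Set X, #S ≤ χ → ∀ j, ∃ i ∈ P S, ∀ x ∈ S, g i x = g j x :=
    fun S hS => ((hpick S).choose_spec hS).2
  let sat : Set ι → Set X := fun I => ⋃ i : I, ⋃ y : {x | (g i x).isSome}, {x | E y.1 x}
  have hsat : ∀ I x, x ∈ sat I ↔ ∃ i ∈ I, ∃ y, (g i y).isSome ∧ E y x := by
    intro I x
    simp [sat]
  have hsatc : ∀ I : Set ι, #I ≤ χ → #(sat I) ≤ χ := by
    intro I hI
    refine union_le χ h0 _ hI fun i => union_le χ h0 _ ((hD i).le.trans hχ) fun y => hEc _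
  obtain ⟨J, hJ⟩ : ∃ J : W → Set ι, ∀ a, J a = P (sat (⋃ b : Iio a, J b.1)) := by
    refine ⟨WellFounded.fix (wellFounded_lt (α := W))
      (fun a F => P (sat (⋃ b : Iio a, F b.1 b.2))), fun a => ?_⟩
    exact WellFounded.fix_eq _ _ a
  have hJc : ∀ a, #(J a) ≤ χ := by
    intro a
    induction a using WellFoundedLT.induction with
    | _ a ih =>
    rw [hJ a]
    exact hPc _ (hsatc _ (union_le χ h0 _ ((hI a).le.trans hχ) fun b => ih b.1 b.2))
  have hU : #(⋃ a, J a) ≤ χ := union_le χ h0 _ (hW.le.trans hχ) hJc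
  obtain ⟨j, hj⟩ : ∃ j, j ∉ ⋃ a, J a := by
    by_contra! hall
    rw [eq_univ_of_forall hall, mk_univ] at hU
    exact absurd hι (not_lt.2 hU)
  have hy : ∀ y : {y | (g j y).isSome}, ∃ a, y.1 ∈ sat (⋃ a, J a) → y.1 ∈ sat (J a) := by
    intro y
    by_cases hys : y.1 ∈ sat (⋃ a, J a)
    · obtain ⟨i, hi, z, hz, hzy⟩ := (hsat _ _).1 hys
      obtain ⟨a, ha⟩ := mem_iUnion.1 hi
      exact ⟨a, fun _ => (hsat _ _).2 ⟨i, ha, z, hz, hzy⟩⟩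
    · haveI : Nonempty W := by
        rw [← mk_ne_zero_iff, hW]; exact h.ne_zero
      exact ⟨Classical.arbitrary W, fun hh => absurd hh hys⟩
  choose A hA using hy
  obtain ⟨a, ha⟩ := hb (range A) (mk_range_le.trans_lt (hD j))
  have hSc : #(sat (⋃ b : Iio a, J b.1)) ≤ χ :=
    hsatc _ (union_le χ h0 _ ((hI a).le.trans hχ) fun b => hJc b.1)
  obtain ⟨i, hi, hij⟩ := hP _ hSc j
  rw [← hJ a] at hi
  refine ⟨i, j, ?_, ?_⟩
  · rintro rfl
    exact hj (mem_iUnion.2 ⟨a, hi⟩)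
  · intro x y hx hy hxy z hxz
    have hyU : y ∈ sat (⋃ a, J a) := (hsat _ _).2 ⟨i, mem_iUnion.2 ⟨a, hi⟩, x, hx, hxy⟩
    obtain ⟨k, hk, w, hw, hwy⟩ := (hsat _ _).1 (hA ⟨y, hy⟩ hyU)
    apply hij
    refine (hsat _ _).2 ⟨k, ?_, w, hw, hE.trans hwy (hE.trans (hE.symm hxy) hxz)⟩
    exact mem_iUnion.2 ⟨⟨A ⟨y, hy⟩, ha _ ⟨_, rfl⟩⟩, hk⟩

section main
variable {lam mu : Cardinal.{0}} {K : Set Cardinal.{0}}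

lemma supBdd (hctx : GroundCtx lam mu K) {κ : Cardinal} (hκ : κ ∈ K) :
    ∀ x ∈ (K ∩ Set.Iio κ) ∪ {lam}, x ≤ κ := by
  rintro x (hx | hx)
  · exact le_of_lt hx.2
  · rw [mem_singleton_iff.1 hx]
    exact (hctx.2.2.2.2.1 κ hκ).2.1

lemma theta_spec (hctx : GroundCtx lam mu K) {κ : Cardinal} (hκ : κ ∈ K) :
    (theta lam K κ).IsRegular ∧ sSup ((K ∩ Set.Iio κ) ∪ {lam}) ≤ theta lam K κ := by
  have hne : {θ : Cardinal | θ.IsRegular ∧ sSup ((K ∩ Set.Iio κ) ∪ {lam}) ≤ θ}.Nonempty :=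
    ⟨κ, (hctx.2.2.2.2.1 κ hκ).1, csSup_le' (supBdd hctx hκ)⟩
  exact csInf_mem hne

lemma theta_mono (hctx : GroundCtx lam mu K) {κ κ' : Cardinal} (hκ' : κ' ∈ K)
    (hle : κ ≤ κ') : theta lam K κ ≤ theta lam K κ' := by
  obtain ⟨h1, h2⟩ := theta_spec hctx hκ'
  refine csInf_le' ⟨h1, le_trans ?_ h2⟩
  refine csSup_le_csSup' ⟨κ', supBdd hctx hκ'⟩ ?_
  rintro x (hx | hx)
  · exact Or.inl ⟨hx.1, lt_of_lt_of_le hx.2 hle⟩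
  · exact Or.inr hx

lemma le_theta (hctx : GroundCtx lam mu K) {κ θ : Cardinal} (hκ : κ ∈ K) (hθ : θ ∈ K)
    (hlt : θ < κ) : θ ≤ theta lam K κ :=
  (le_csSup ⟨κ, supBdd hctx hκ⟩ (Or.inl ⟨hθ, hlt⟩)).trans (theta_spec hctx hκ).2

lemma Ecl_mono {θ θ' : Cardinal.{0}} (h' : ℵ₀ ≤ θ') (hle : θ ≤ θ') {x y : Ordinal}
    (h : x + θ.ord = y + θ.ord) : x + θ'.ord = y + θ'.ord := by
  rcases hle.eq_or_lt with rfl | hlt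
  · exact h
  · have : θ.ord + θ'.ord = θ'.ord :=
      Ordinal.isPrincipal_add_iff_add_left_eq_self.1 (Ordinal.isPrincipal_add_ord h') _ (ord_lt_ord.2 hlt)
    rw [← this, ← add_assoc, h, add_assoc]

/-- the relation `E_{<κ}` -/
def Erel (K : Set Cardinal.{0}) (κ : Cardinal.{0}) (x y : Ordinal.{0}) : Prop :=
  x = y ∨ ∃ θ ∈ K, θ < κ ∧ x + θ.ord = y + θ.ord

lemma Erel_equiv (hctx : GroundCtx lam mu K) (κ : Cardinal) : Equivalence (Erel K κ) := by
  refine ⟨fun x => Or.inl rfl, ?_, ?_⟩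
  · rintro x y (h | ⟨θ, h1, h2, h3⟩)
    · exact Or.inl h.symm
    · exact Or.inr ⟨θ, h1, h2, h3.symm⟩
  · rintro x y z (rfl | ⟨θ, h1, h2, h3⟩) (rfl | ⟨θ', h1', h2', h3'⟩)
    · exact Or.inl rfl
    · exact Or.inr ⟨θ', h1', h2', h3'⟩
    · exact Or.inr ⟨θ, h1, h2, h3⟩
    · rcases le_total θ θ' with hle | hle
      · exact Or.inr ⟨θ', h1', h2',
          (Ecl_mono (hctx.2.2.2.2.1 θ' h1').1.aleph0_le hle h3).trans h3'⟩
      · exact Or.inr ⟨θ, h1, h2,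
          h3.trans (Ecl_mono (hctx.2.2.2.2.1 θ h1).1.aleph0_le hle h3')⟩

lemma Erel_card (hctx : GroundCtx lam mu K) {κ : Cardinal} (hκ : κ ∈ K) (x : Ordinal) :
    #{y | Erel K κ x y} ≤ Cardinal.lift.{1} (theta lam K κ) := by
  have hE := Erel_equiv hctx κ
  set m := sInf {y | Erel K κ x y} with hm
  have hmm : Erel K κ x m := csInf_mem (s := {y | Erel K κ x y}) ⟨x, hE.refl x⟩
  have hpos := (theta_spec hctx hκ).1.ord_pos
  have hlt : ∀ y, Erel K κ x y → y - m < (theta lam K κ).ord := by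
    intro y hy
    rcases hE.trans (hE.symm hmm) hy with rfl | ⟨θ, h1, h2, h3⟩
    · simpa using hpos
    · have hθ : (0 : Ordinal) < θ.ord := (hctx.2.2.2.2.1 θ h1).1.ord_pos
      have h4 : y < m + θ.ord := by
        rw [h3]; exact lt_add_of_pos_right y hθ
      have h5 : y - m < θ.ord := Ordinal.sub_lt_of_lt_add h4 hθ
      exact h5.trans_le (ord_le_ord.2 (le_theta hctx hκ h1 h2))
  have hcard : #(Iio (theta lam K κ).ord) = Cardinal.lift.{1} (theta lam K κ) := by
    rw [mk_Iio_ordinal, card_ord]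
  rw [← hcard]
  refine mk_le_of_injective
    (f := fun y : {y | Erel K κ x y} => (⟨y.1 - m, hlt y.1 y.2⟩ : Iio (theta lam K κ).ord)) ?_
  rintro ⟨y, hy⟩ ⟨z, hz⟩ hyz
  have hyz : y - m = z - m := congrArg Subtype.val hyz
  apply Subtype.ext
  change y = z
  have hy' : m ≤ y := csInf_le' hy
  have hz' : m ≤ z := csInf_le' hz
  rw [← Ordinal.add_sub_cancel_of_le hy', ← Ordinal.add_sub_cancel_of_le hz', hyz]

/-- the new part of the condition `q` over `p` -/
def newPart (p q : Cond) : Cond := fun x => if (p x).isSome then none else q x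

lemma newPart_isSome (p q : Cond) (x : Ordinal) :
    (newPart p q x).isSome ↔ (q x).isSome ∧ ¬ (p x).isSome := by
  unfold newPart
  split_ifs with h <;> simp [h]

lemma newPart_card (hctx : GroundCtx lam mu K) {κ : Cardinal} (hκ : κ ∈ K) {p q : Cond}
    (hq : inQ lam mu K q) (hpq : condLeApr lam mu K κ p q) :
    #{x | (newPart p q x).isSome} < Cardinal.lift.{1} (theta lam K κ) := by
  have hreg : (Cardinal.lift.{1} (theta lam K κ)).IsRegular := (theta_spec hctx hκ).1.lift
  have hsub : {x | (newPart p q x).isSome} ⊆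
      ⋃ A ∈ growClasses mu κ (cdom p) (cdom q), A ∩ cdom q := by
    intro x hx
    obtain ⟨h1, h2⟩ := (newPart_isSome p q x).1 hx
    simp only [mem_iUnion]
    refine ⟨Ecl κ x, ⟨⟨x, hq.1 h1, rfl⟩, hpq.2 x h1, ?_⟩, rfl, h1⟩
    intro heq
    have : x ∈ Ecl κ x ∩ cdom q := ⟨rfl, h1⟩
    rw [← heq] at this
    exact h2 this.2
  refine (mk_le_mk_of_subset hsub).trans_lt ?_
  rw [card_biUnion_lt_iff_forall_of_isRegular hreg (hpq.1.2 κ hκ)]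
  rintro A ⟨⟨i, hi, rfl⟩, _⟩
  exact hq.2 i hi κ hκ

lemma condLe_dom {p q : Cond} (h : condLe lam mu K p q) : cdom p ⊆ cdom q := by
  intro x hx
  obtain ⟨b, hb⟩ := Option.isSome_iff_exists.1 hx
  exact Option.isSome_iff_exists.2 ⟨b, h.1 x b hb⟩

lemma half (hctx : GroundCtx lam mu K) {κ : Cardinal} (hκ : κ ∈ K) {p q₁ q₂ r : Cond}
    (hQ₂ : inQ lam mu K q₂)
    (h₁ : condLeApr lam mu K κ p q₁) (h₂ : condLeApr lam mu K κ p q₂)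
    (hag : ∀ x y, (newPart p q₁ x).isSome → (newPart p q₂ y).isSome → Erel K κ x y →
      newPart p q₁ y = newPart p q₂ y)
    (hr : cdom r = cdom q₁ ∪ cdom q₂) (hext : ∀ i b, q₁ i = some b → r i = some b) :
    condLe lam mu K q₁ r := by
  have hd1 := condLe_dom h₁.1
  refine ⟨hext, fun κ' hκ' => ?_⟩
  have hgr : ∀ A, grows A (cdom q₁) (cdom r) →
      (∃ x ∈ A, x ∈ cdom q₁) ∧ ∃ y ∈ A, y ∈ cdom q₂ ∧ y ∉ cdom q₁ := by
    rintro A ⟨⟨x, hx, hx'⟩, hne⟩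
    refine ⟨⟨x, hx, hx'⟩, ?_⟩
    by_contra! hcon
    apply hne
    rw [hr]
    ext z
    constructor
    · exact fun hz => ⟨hz.1, Or.inl hz.2⟩
    · rintro ⟨hz, hz' | hz'⟩
      · exact ⟨hz, hz'⟩
      · exact ⟨hz, hcon z hz hz'⟩
  rcases le_or_gt κ κ' with hle | hlt
  · have hsub : growClasses mu κ' (cdom q₁) (cdom r) ⊆
        (Ecl κ') '' {x | (newPart p q₂ x).isSome} := by
      rintro A ⟨⟨i, hi, rfl⟩, hg⟩
      obtain ⟨-, y, hyA, hy2, hy1⟩ := hgr _ hg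
      refine ⟨y, (newPart_isSome _ _ _).2 ⟨hy2, fun hyp => hy1 (hd1 hyp)⟩, ?_⟩
      have hyA' : y + κ'.ord = i + κ'.ord := hyA
      unfold Ecl
      rw [hyA']
    refine (mk_le_mk_of_subset hsub).trans_lt (mk_image_le.trans_lt ?_)
    exact (newPart_card hctx hκ hQ₂ h₂).trans_le (lift_le.2 (theta_mono hctx hκ' hle))
  · have hsub : growClasses mu κ' (cdom q₁) (cdom r) ⊆ growClasses mu κ' (cdom p) (cdom q₂) := by
      rintro A ⟨⟨i, hi, rfl⟩, hg⟩
      obtain ⟨⟨x, hxA, hx1⟩, y, hyA, hy2, hy1⟩ := hgr _ hg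
      have hyp : y ∉ cdom p := fun hyp => hy1 (hd1 hyp)
      refine ⟨⟨i, hi, rfl⟩, ?_, ?_⟩
      · by_contra hemp
        have hxp : x ∉ cdom p := fun hxp => hemp ⟨x, hxA, hxp⟩
        have hxA' : x + κ'.ord = i + κ'.ord := hxA
        have hyA' : y + κ'.ord = i + κ'.ord := hyA
        have hy2' := (newPart_isSome p q₂ y).2 ⟨hy2, hyp⟩
        have := hag x y ((newPart_isSome _ _ _).2 ⟨hx1, hxp⟩) hy2'
          (Or.inr ⟨κ', hκ', hlt, hxA'.trans hyA'.symm⟩)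
        rw [← this] at hy2'
        exact hy1 ((newPart_isSome _ _ _).1 hy2').1
      · intro heq
        have : y ∈ Ecl κ' i ∩ cdom q₂ := ⟨hyA, hy2⟩
        rw [← heq] at this
        exact hyp this.2
    exact (mk_le_mk_of_subset hsub).trans_lt (h₂.1.2 κ' hκ')

lemma compat_of_agree (hctx : GroundCtx lam mu K) {κ : Cardinal} (hκ : κ ∈ K) {p q₁ q₂ : Cond}
    (hQ₁ : inQ lam mu K q₁) (hQ₂ : inQ lam mu K q₂)
    (h₁ : condLeApr lam mu K κ p q₁) (h₂ : condLeApr lam mu K κ p q₂)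
    (hag : ∀ x y, (newPart p q₁ x).isSome → (newPart p q₂ y).isSome → Erel K κ x y →
      ∀ z, Erel K κ x z → newPart p q₁ z = newPart p q₂ z) :
    compatQ lam mu K q₁ q₂ := by
  have hE := Erel_equiv hctx κ
  have hr : cdom (unionC q₁ q₂) = cdom q₁ ∪ cdom q₂ := by
    ext x
    simp only [cdom, unionC, mem_union, mem_ofPred_eq]
    cases q₁ x <;> simp
  have hext1 : ∀ i b, q₁ i = some b → unionC q₁ q₂ i = some b := by
    intro i b h
    simp [unionC, h]
  have hext2 : ∀ i b, q₂ i = some b → unionC q₁ q₂ i = some b := by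
    intro i b h
    cases h1 : q₁ i with
    | none => simp [unionC, h1, h]
    | some c =>
      rw [hext1 i c h1, ← h1, ← h]
      cases hpi : p i with
      | some d => rw [h₁.1.1 i d hpi, h₂.1.1 i d hpi]
      | none =>
        have e1 : newPart p q₁ i = q₁ i := by simp [newPart, hpi]
        have e2 : newPart p q₂ i = q₂ i := by simp [newPart, hpi]
        rw [← e1, ← e2]
        exact hag i i (by rw [e1, h1]; rfl) (by rw [e2, h]; rfl) (hE.refl i) i (hE.refl i)
  refine ⟨unionC q₁ q₂, ⟨?_, ?_⟩, ?_, ?_⟩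
  · rw [hr]; exact union_subset hQ₁.1 hQ₂.1
  · intro i hi κ' hκ'
    rw [hr, inter_union_distrib_left]
    refine (mk_union_le _ _).trans_lt ?_
    exact add_lt_of_lt ((theta_spec hctx hκ').1.lift.aleph0_le) (hQ₁.2 i hi κ' hκ')
      (hQ₂.2 i hi κ' hκ')
  · exact half hctx hκ hQ₂ h₁ h₂ (fun x y hx hy hxy => hag x y hx hy hxy y hxy) hr hext1
  · refine half hctx hκ hQ₁ h₂ h₁ (fun x y hx hy hxy => ?_) (by rw [hr, union_comm]) hext2
    exact (hag y x hy hx (hE.symm hxy) y (hE.refl y)).symm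

end main

/-- the suborder `Q^{apr}_{κ,p}` satisfies the `(2^{<θ_κ})⁺`-chain
condition: among `(2^{<θ_κ})⁺` many conditions above `p` (in `≤apr_κ`) there are two
(with distinct indices) compatible in `Q`. -/
theorem stmt14 (lam mu : Cardinal) (K : Set Cardinal) (hctx : GroundCtx lam mu K)
    (κ : Cardinal) (hκ : κ ∈ K) (p : Cond) (hp : inQ lam mu K p)
    (f : Ordinal → Cond)
    (hfQ : ∀ i < (Order.succ (2 ^< theta lam K κ)).ord, inQ lam mu K (f i))
    (hf : ∀ i < (Order.succ (2 ^< theta lam K κ)).ord, condLeApr lam mu K κ p (f i)) :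
    ∃ i j : Ordinal, i < (Order.succ (2 ^< theta lam K κ)).ord ∧
      j < (Order.succ (2 ^< theta lam K κ)).ord ∧ i ≠ j ∧
      compatQ lam mu K (f i) (f j) := by
  set θ := theta lam K κ with hθ
  have hreg : θ.IsRegular := (theta_spec hctx hκ).1
  let ι := ↥(Iio (Order.succ (2 ^< θ)).ord)
  have hpow : ∀ c < Cardinal.lift.{1} θ,
      (Cardinal.lift.{1} (2 ^< θ)) ^ c ≤ Cardinal.lift.{1} (2 ^< θ) := by
    intro c hc
    obtain ⟨d, hd, rfl⟩ := lt_lift_iff.1 hc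
    rw [← lift_power, lift_le]
    exact powerlt_pow θ hreg d hd
  have hcard : Cardinal.lift.{1} (2 ^< θ) < #ι := by
    rw [mk_Iio_ordinal, card_ord, lift_lt]
    exact Order.lt_succ _
  obtain ⟨i, j, hij, hag⟩ := core (ι := ι) (Cardinal.lift.{1} θ) (Cardinal.lift.{1} (2 ^< θ))
    hreg.lift (lift_le.2 (le_two_powerlt θ)) hpow (Erel K κ) (Erel_equiv hctx κ)
    (fun x => (Erel_card hctx hκ x).trans (lift_le.2 (le_two_powerlt θ)))
    (fun i => newPart p (f i.1))
    (fun i => newPart_card hctx hκ (hfQ i.1 i.2) (hf i.1 i.2)) hcard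
  exact ⟨i.1, j.1, i.2, j.2, fun h => hij (Subtype.ext h),
    compat_of_agree hctx hκ (hfQ _ i.2) (hfQ _ j.2) (hf _ i.2) (hf _ j.2) hag⟩
end
end

section
/- Assuming 2^θ = θ⁺ for all cardinals θ ∈ [λ, μ]: forcing with Q preserves cofinalities and hence cardinals. In particular, Q has cardinality μ, adds no new sequences of length < λ (by λ-completeness), has the (2^{<θ_μ})⁺-c.c. with 2^{<θ_μ} ≤ μ, and for regular τ with λ ≤ τ < σ ≤ μ, no condition forces cf(σ) = τ, using the decision lemma at the κ ∈ K with θ_κ ≤ τ < κ. -/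
open Cardinal Set

noncomputable section

attribute [local instance] Classical.propDecidable

universe u

theorem aux_iUnion_le {ι α : Type u} {θ : Cardinal.{u}} (h0 : ℵ₀ ≤ θ) (f : ι → Set α)
    (hι : #ι ≤ θ) (hf : ∀ i, #(f i) ≤ θ) : #(⋃ i, f i : Set α) ≤ θ := by
  refine (mk_iUnion_le f).trans ?_
  refine (mul_le_mul' hι (ciSup_le' hf)).trans ?_
  rw [mul_eq_self h0]

theorem aux_bdd {θ : Cardinal.{u}} (hθ : θ.IsRegular) {α : Type u} (hα : #α < θ)
    (f : α → θ.ord.ToType) : ∃ w, ∀ a, f a < w := by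
  have h : ¬ IsCofinal (range f) := by
    intro h
    have := Order.cof_le h
    rw [Ordinal.cof_toType, hθ.cof_ord] at this
    exact absurd (this.trans mk_range_le) (not_le.2 hα)
  simp only [IsCofinal, not_forall] at h
  obtain ⟨w, hw⟩ := h
  refine ⟨w, fun a => ?_⟩
  by_contra h
  exact hw ⟨f a, mem_range_self a, not_lt.1 h⟩

theorem aux_exists_Iio {θ c : Cardinal.{u}} (hc : c < θ) : ∃ w : θ.ord.ToType, c = #(Iio w) := by
  have h1 : c.ord < Ordinal.type (· < · : θ.ord.ToType → θ.ord.ToType → Prop) := by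
    rw [Ordinal.type_toType]; exact ord_lt_ord.2 hc
  refine ⟨Ordinal.enum (· < ·) ⟨c.ord, h1⟩, ?_⟩
  have := Ordinal.typein_enum (· < · : θ.ord.ToType → θ.ord.ToType → Prop) h1
  have h2 := congrArg Ordinal.card this
  rw [card_ord] at h2
  exact h2.symm

theorem aux_pow_le {θ : Cardinal.{u}} (hθ : θ.IsRegular) (lam mu : Cardinal.{u}) (hl : ℵ₀ ≤ lam)
    (hlt : lam < θ) (hle : θ ≤ mu)
    (hGCH : ∀ θc : Cardinal, lam ≤ θc → θc ≤ mu → (2 : Cardinal) ^ θc = Order.succ θc)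
    (ν : Cardinal.{u}) (hν : ν < θ) : θ ^ ν ≤ θ := by
  have h1 : θ ^ ν = #(ν.out → θ.ord.ToType) := by
    simp
  rw [h1, ← mk_univ]
  have h2 : (univ : Set (ν.out → θ.ord.ToType)) ⊆ ⋃ w : θ.ord.ToType, {f | ∀ a, f a ∈ Iio w} := by
    intro f _
    obtain ⟨w, hw⟩ := aux_bdd hθ (by simpa using hν) f
    exact mem_iUnion.2 ⟨w, hw⟩
  refine (mk_le_mk_of_subset h2).trans (aux_iUnion_le hθ.aleph0_le _ (by simp) fun w => ?_)
  have h3 : #{f : ν.out → θ.ord.ToType | ∀ a, f a ∈ Iio w} ≤ #(ν.out → Iio w) :=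
    mk_le_of_injective (f := fun f a => ⟨f.1 a, f.2 a⟩) (by
      intro f g h
      ext a
      have := congrFun h a
      simpa using this)
  refine h3.trans ?_
  have h4 : #(Iio w) < θ := mk_Iio_toType_ord_lt w
  set m := max (max #(Iio w) ν) lam
  have hm : m < θ := max_lt (max_lt h4 hν) hlt
  have hm0 : ℵ₀ ≤ m := hl.trans (le_max_right _ _)
  calc #(ν.out → Iio w) = #(Iio w) ^ ν := by simp
    _ ≤ m ^ ν := power_le_power_right ((le_max_left _ _).trans (le_max_left _ _))
    _ ≤ m ^ m := power_le_power_left (aleph0_pos.trans_le hm0).ne'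
        ((le_max_right _ _).trans (le_max_left _ _))
    _ = 2 ^ m := power_self_eq hm0
    _ = Order.succ m := hGCH m (le_max_right _ _) (hm.le.trans hle)
    _ ≤ θ := Order.succ_le_of_lt hm

def odom {X : Type u} (h : X → Option Bool) : Set X := {x | (h x).isSome}

theorem aux_count_sets {X : Type u} {θ : Cardinal.{u}} (h0 : ℵ₀ ≤ θ)
    (hp : ∀ ν < θ, θ ^ ν ≤ θ) (D : Set X) (hD : #D ≤ θ) :
    #{s : Set X | s ⊆ D ∧ #s < θ} ≤ θ := by
  have h2 : {s : Set X | s ⊆ D ∧ #s < θ} ⊆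
      ⋃ w : θ.ord.ToType, {s | s ⊆ D ∧ #s ≤ #(Iio w)} := by
    rintro s ⟨h1, h2⟩
    obtain ⟨w, hw⟩ := aux_exists_Iio h2
    exact mem_iUnion.2 ⟨w, h1, hw.le⟩
  refine (mk_le_mk_of_subset h2).trans (aux_iUnion_le h0 _ (by simp) fun w => ?_)
  refine (mk_bounded_subset_le D _).trans ?_
  refine (power_le_power_right (max_le hD h0)).trans (hp _ (mk_Iio_toType_ord_lt w))

theorem aux_count {X : Type u} {θ : Cardinal.{u}} (h0 : ℵ₀ ≤ θ)
    (hp : ∀ ν < θ, θ ^ ν ≤ θ) (D : Set X) (hD : #D ≤ θ) :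
    #{h : X → Option Bool | odom h ⊆ D ∧ #(odom h) < θ} ≤ θ := by
  let S := {s : Set X | s ⊆ D ∧ #s < θ}
  have key : #{h : X → Option Bool | odom h ⊆ D ∧ #(odom h) < θ} ≤ #(S × S) := by
    have hs : ∀ (h : X → Option Bool) (b : Bool), {x | h x = some b} ⊆ odom h := by
      intro h b x hx
      simp only [mem_ofPred_eq] at hx
      simp [odom, hx]
    refine mk_le_of_injective (f := fun h =>
      (⟨{x | h.1 x = some true}, (hs _ _).trans h.2.1, (mk_le_mk_of_subset (hs _ _)).trans_lt h.2.2⟩,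
       ⟨{x | h.1 x = some false}, (hs _ _).trans h.2.1, (mk_le_mk_of_subset (hs _ _)).trans_lt h.2.2⟩)) ?_
    rintro ⟨h, hh⟩ ⟨g, hg⟩ he
    simp only [Prod.mk.injEq, Subtype.mk.injEq, Set.ext_iff, mem_ofPred_eq] at he
    ext1
    funext x
    have h1 := he.1 x
    have h2 := he.2 x
    show h x = g x
    rcases hx : h x with _ | _ | _ <;> rcases hy : g x with _ | _ | _ <;> simp_all
  refine key.trans ?_
  rw [mk_prod]
  simp only [lift_id]
  refine (mul_le_mul' (aux_count_sets h0 hp D hD) (aux_count_sets h0 hp D hD)).trans ?_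
  rw [mul_eq_self h0]

def ores {X : Type u} (h : X → Option Bool) (D : Set X) : X → Option Bool :=
  fun x => if x ∈ D then h x else none

theorem aux_cc {X I : Type u} {θ : Cardinal.{u}} (hθ : θ.IsRegular)
    (hp : ∀ ν < θ, θ ^ ν ≤ θ) (e : X → X → Prop) (he : Equivalence e)
    (hcl : ∀ x, #{y | e x y} ≤ θ) (g : I → X → Option Bool) (hg : ∀ i, #(odom (g i)) < θ)
    (hI : θ < #I) :
    ∃ i j, i ≠ j ∧ ∀ x ∈ odom (g i), ∀ y ∈ odom (g j), e x y → ∀ z, e x z → g i z = g j z := by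
  have h0 := hθ.aleph0_le
  have hI' : Nonempty I := by
    rw [← mk_ne_zero_iff]; intro h; rw [h] at hI; exact not_lt_bot hI
  let tr : Set X → I → (X → Option Bool) := fun D b => ores (g b) D
  let a : Set X → I → I := fun D b => Function.invFun (tr D) (tr D b)
  have ha : ∀ D b, tr D (a D b) = tr D b := fun D b => Function.invFun_eq ⟨b, rfl⟩
  let T : Set X → Set X := fun D => ⋃ j : range (a D), ⋃ x : odom (g j.1), {y | e x.1 y}
  have hJ : ∀ D : Set X, #D ≤ θ → #(range (a D)) ≤ θ := by
    intro D hD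
    have h1 : range (a D) ⊆ Function.invFun (tr D) '' {h | odom h ⊆ D ∧ #(odom h) < θ} := by
      rintro _ ⟨b, rfl⟩
      refine ⟨tr D b, ⟨?_, ?_⟩, rfl⟩
      · intro x hx
        by_contra hxD
        simp [odom, tr, ores, hxD] at hx
      · refine (mk_le_mk_of_subset ?_).trans_lt (hg b)
        intro x hx
        by_cases hxD : x ∈ D
        · simpa [odom, tr, ores, hxD] using hx
        · simp [odom, tr, ores, hxD] at hx
    exact (mk_le_mk_of_subset h1).trans (mk_image_le.trans (aux_count h0 hp D hD))
  have hT : ∀ D : Set X, #D ≤ θ → #(T D) ≤ θ := fun D hD =>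
    aux_iUnion_le h0 _ (hJ D hD) fun j => aux_iUnion_le h0 _ (hg _).le fun x => hcl _
  have hTcl : ∀ D x y, x ∈ T D → e x y → y ∈ T D := by
    intro D x y hx hxy
    simp only [T, mem_iUnion] at hx ⊢
    obtain ⟨j, z, hz⟩ := hx
    exact ⟨j, z, he.trans hz hxy⟩
  let W := θ.ord.ToType
  have wf : WellFounded ((· < ·) : W → W → Prop) := wellFounded_lt
  let D : W → Set X := wf.fix (fun w D => ⋃ v : Iio w, T (D v.1 v.2))
  have hDeq : ∀ w, D w = ⋃ v : Iio w, T (D v.1) := fun w => wf.fix_eq _ w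
  have hDc : ∀ w, #(D w) ≤ θ := by
    intro w
    induction w using wf.induction with
    | _ w ih =>
      rw [hDeq]
      exact aux_iUnion_le h0 _ (mk_Iio_toType_ord_lt w).le fun v => hT _ (ih v.1 v.2)
  have hsmall : #(⋃ w : W, range (a (D w)) : Set I) ≤ θ :=
    aux_iUnion_le h0 _ (by simp [W]) fun w => hJ _ (hDc w)
  obtain ⟨b, hb⟩ : ∃ b, b ∉ (⋃ w : W, range (a (D w)) : Set I) := by
    by_contra h
    push Not at h
    rw [eq_univ_of_forall h, mk_univ] at hsmall
    exact absurd hsmall (not_le.2 hI)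
  let Y : Set X := {x | x ∈ odom (g b) ∧ ∃ w, x ∈ T (D w)}
  have hY : #Y < θ := (mk_le_mk_of_subset (fun x hx => hx.1)).trans_lt (hg b)
  choose wf' hwf' using (fun x : Y => x.2.2)
  obtain ⟨w, hw⟩ := aux_bdd hθ hY wf'
  have hbw : ∀ x ∈ odom (g b), ∀ v, x ∈ T (D v) → x ∈ D w := by
    intro x hx v hv
    have hxY : x ∈ Y := ⟨hx, v, hv⟩
    rw [hDeq, mem_iUnion]
    exact ⟨⟨wf' ⟨x, hxY⟩, hw ⟨x, hxY⟩⟩, hwf' ⟨x, hxY⟩⟩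
  have hDcl : ∀ x y, x ∈ D w → e x y → y ∈ D w := by
    intro x y hx hxy
    rw [hDeq, mem_iUnion] at hx ⊢
    obtain ⟨v, hv⟩ := hx
    exact ⟨v, hTcl _ _ _ hv hxy⟩
  refine ⟨a (D w) b, b, ?_, ?_⟩
  · intro h
    exact hb (mem_iUnion.2 ⟨w, b, h⟩)
  · intro x hx y hy hxy z hxz
    have hyT : y ∈ T (D w) := by
      simp only [T, mem_iUnion]
      exact ⟨⟨a (D w) b, mem_range_self b⟩, ⟨x, hx⟩, hxy⟩
    have hyD := hbw y hy w hyT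
    have hzD := hDcl y z hyD (he.trans (he.symm hxy) hxz)
    have := congrFun (ha (D w) b) z
    simpa [tr, ores, hzD] using this

theorem aux_seq {P : Type u} {O : Type u} [LinearOrder O] [WellFoundedLT O]
    (R : P → P → Prop) (hR : ∀ x y z, R x y → R y z → R x z) (p0 : P) (Δ : Set O)
    (hΔ : ∀ i ∈ Δ, ∀ j < i, j ∈ Δ)
    (hb : ∀ δ ∈ Δ, ∀ f : O → P, (∀ i < δ, R p0 (f i)) → (∀ i j, i < j → j < δ → R (f i) (f j)) →
      ∃ v, R p0 v ∧ ∀ i < δ, R (f i) v)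
    (S : (O → P) → O → P → P → Prop)
    (hS : ∀ h, ∀ i ∈ Δ, ∀ p, R p0 p → ∃ q, R p q ∧ S h i p q) :
    ∃ f w : O → P, ∀ i ∈ Δ, R p0 (w i) ∧ R (w i) (f i) ∧ (∀ j < i, R (f j) (w i)) ∧
      ∃ h : O → P, (∀ j < i, h j = f j) ∧ S h i (w i) (f i) := by
  have wf : WellFounded ((· < ·) : O → O → Prop) := wellFounded_lt
  let H : ∀ i : O, (∀ j, j < i → P) → O → P := fun i g j => if hj : j < i then g j hj else p0
  let UU : ∀ i : O, (O → P) → P := fun i h =>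
    if hx : ∃ v, R p0 v ∧ ∀ j < i, R (h j) v then hx.choose else p0
  let F : ∀ i : O, (O → P) → P := fun i h =>
    if hx : ∃ q, R (UU i h) q ∧ S h i (UU i h) q then hx.choose else p0
  let f : O → P := wf.fix (fun i g => F i (H i g))
  have hf : ∀ i, f i = F i (H i (fun j _ => f j)) := fun i => wf.fix_eq _ i
  let hh : O → O → P := fun i => H i (fun j _ => f j)
  have hhj : ∀ i, ∀ j < i, hh i j = f j := fun i j hj => by simp [hh, H, hj]
  refine ⟨f, fun i => UU i (hh i), ?_⟩
  intro i
  induction i using wf.induction with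
  | _ i ih =>
    intro hi
    have hx : ∃ v, R p0 v ∧ ∀ j < i, R (hh i j) v := by
      obtain ⟨v, hv, hv'⟩ := hb i hi f
        (fun j hj => hR _ _ _ (ih j hj (hΔ i hi j hj)).1 (ih j hj (hΔ i hi j hj)).2.1)
        (fun j k hjk hk => hR _ _ _ ((ih k hk (hΔ i hi k hk)).2.2.1 j hjk)
          (ih k hk (hΔ i hi k hk)).2.1)
      exact ⟨v, hv, fun j hj => by rw [hhj i j hj]; exact hv' j hj⟩
    have hU : UU i (hh i) = hx.choose := by simp only [UU]; rw [dif_pos hx]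
    have hU1 : R p0 (UU i (hh i)) := by rw [hU]; exact hx.choose_spec.1
    have hU2 : ∀ j < i, R (f j) (UU i (hh i)) := fun j hj => by
      rw [hU, ← hhj i j hj]; exact hx.choose_spec.2 j hj
    have hy := hS (hh i) i hi _ hU1
    have hF : f i = hy.choose := by rw [hf i]; simp only [F]; exact dif_pos hy
    refine ⟨hU1, ?_, hU2, hh i, hhj i, ?_⟩
    · rw [hF]; exact hy.choose_spec.1
    · rw [hF]; exact hy.choose_spec.2


theorem th_spec {lam mu : Cardinal.{0}} {K : Set Cardinal.{0}} (hctx : GroundCtx lam mu K)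
    {κ : Cardinal.{0}} (hκ : κ ∈ K) :
    (theta lam K κ).IsRegular ∧ lam ≤ theta lam K κ ∧ theta lam K κ ≤ κ ∧
      ∀ κ' ∈ K, κ' < κ → κ' ≤ theta lam K κ := by
  obtain ⟨-, -, -, -, hK, -, -⟩ := hctx
  have hub : κ ∈ upperBounds ((K ∩ Set.Iio κ) ∪ {lam}) := by
    rintro x (hx | hx)
    · exact hx.2.le
    · rw [mem_singleton_iff] at hx; rw [hx]; exact (hK κ hκ).2.1
  have hmem : κ ∈ {θ : Cardinal | θ.IsRegular ∧ sSup ((K ∩ Set.Iio κ) ∪ {lam}) ≤ θ} :=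
    ⟨(hK κ hκ).1, csSup_le' hub⟩
  have h := csInf_mem (⟨κ, hmem⟩ : Set.Nonempty _)
  refine ⟨h.1, (le_csSup ⟨κ, hub⟩ (Or.inr rfl)).trans h.2, csInf_le' hmem, ?_⟩
  intro κ' hκ' hlt
  exact (le_csSup ⟨κ, hub⟩ (Or.inl ⟨hκ', hlt⟩)).trans h.2

theorem th_le {lam : Cardinal.{0}} {K : Set Cardinal.{0}}
    {κ τ : Cardinal.{0}} (hτ : τ.IsRegular) (hl : lam ≤ τ) (h : ∀ κ' ∈ K, κ' < κ → κ' ≤ τ) :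
    theta lam K κ ≤ τ := by
  refine csInf_le' ⟨hτ, csSup_le' ?_⟩
  rintro x (hx | hx)
  · exact h x hx.1 hx.2
  · rw [mem_singleton_iff] at hx; rw [hx]; exact hl

theorem th_mono {lam mu : Cardinal.{0}} {K : Set Cardinal.{0}} (hctx : GroundCtx lam mu K)
    {κ κ' : Cardinal.{0}} (hκ' : κ' ∈ K) (h : κ ≤ κ') :
    theta lam K κ ≤ theta lam K κ' := by
  obtain ⟨h1, h2, -, h4⟩ := th_spec hctx hκ'
  exact th_le h1 h2 fun x hx hlt => h4 x hx (hlt.trans_le h)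

theorem lam_lt_mu {lam mu : Cardinal.{0}} {K : Set Cardinal.{0}} (hctx : GroundCtx lam mu K) :
    lam < mu := by
  obtain ⟨h1, -, h3, h4, -, -, -⟩ := hctx
  calc lam < 2 ^ lam := cantor lam
    _ ≤ mu ^ lam := power_le_power_right (h3.nat_lt 2).le
    _ = mu := h4

theorem pow_le_gen {lam mu : Cardinal.{0}} {K : Set Cardinal.{0}} (hctx : GroundCtx lam mu K)
    (hGCH : ∀ θc : Cardinal, lam ≤ θc → θc ≤ mu → (2 : Cardinal) ^ θc = Order.succ θc)
    {θ : Cardinal.{0}} (hθ : θ.IsRegular) (h1 : lam ≤ θ) (h2 : θ ≤ mu) :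
    ∀ ν < θ, θ ^ ν ≤ θ := by
  intro ν hν
  rcases h1.eq_or_lt with h | h
  · subst h
    exact (le_powerlt _ hν).trans hctx.2.1.le
  · exact aux_pow_le hθ lam mu hctx.1.aleph0_le h h2 hGCH ν hν

theorem pow_le_lift {θ : Cardinal.{0}} (h : ∀ ν < θ, θ ^ ν ≤ θ) :
    ∀ ν < Cardinal.lift.{1} θ, (Cardinal.lift.{1} θ) ^ ν ≤ Cardinal.lift.{1} θ := by
  intro ν hν
  obtain ⟨ν', rfl⟩ := mem_range_lift_of_le hν.le
  rw [← lift_power, lift_le]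
  exact h _ (lift_lt.1 hν)

theorem Ecl_refl (κ : Cardinal.{0}) (i : Ordinal.{0}) : i ∈ Ecl κ i := rfl

theorem Ecl_eq {κ : Cardinal.{0}} {i j : Ordinal.{0}} (h : j ∈ Ecl κ i) : Ecl κ i = Ecl κ j := by
  ext z
  show z + κ.ord = i + κ.ord ↔ z + κ.ord = j + κ.ord
  rw [show j + κ.ord = i + κ.ord from h]

theorem Ecl_mono_s19 {κ κ' : Cardinal.{0}} (h : κ ≤ κ') (i : Ordinal.{0}) : Ecl κ i ⊆ Ecl κ' i := by
  intro j hj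
  show j + κ'.ord = i + κ'.ord
  rw [← Ordinal.add_sub_cancel_of_le (ord_le_ord.2 h), ← add_assoc, ← add_assoc,
    show j + κ.ord = i + κ.ord from hj]

theorem Ecl_card {κ : Cardinal.{0}} (h0 : 0 < κ) (i : Ordinal.{0}) :
    #(Ecl κ i) ≤ Cardinal.lift.{1} κ := by
  have hne : (Ecl κ i).Nonempty := ⟨i, rfl⟩
  set m := sInf (Ecl κ i)
  have hm : m ∈ Ecl κ i := csInf_mem hne
  have hsub : Ecl κ i ⊆ (fun c => m + c) '' Iio κ.ord := by
    intro j hj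
    have hmj : m ≤ j := csInf_le' hj
    refine ⟨j - m, ?_, Ordinal.add_sub_cancel_of_le hmj⟩
    have h1 : j + κ.ord = m + κ.ord := by
      rw [show j + κ.ord = i + κ.ord from hj, show m + κ.ord = i + κ.ord from hm]
    rw [← Ordinal.add_sub_cancel_of_le hmj, add_assoc] at h1
    have h2 := add_left_cancel h1
    have h3 : j - m ≤ κ.ord := by
      conv_rhs => rw [← h2]
      exact le_self_add
    refine lt_of_le_of_ne h3 fun h4 => ?_
    rw [h4] at h2
    have h5 : κ.ord + κ.ord = κ.ord + 0 := by rw [h2, add_zero]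
    have h6 := add_left_cancel h5
    rw [ord_eq_zero] at h6
    exact h0.ne' h6
  refine (mk_le_mk_of_subset hsub).trans (mk_image_le.trans ?_)
  rw [mk_Iio_ordinal, card_ord]

section
variable {lam mu : Cardinal.{0}} {K : Set Cardinal.{0}}

theorem th1_reg (hctx : GroundCtx lam mu K) {κ : Cardinal.{0}} (hκ : κ ∈ K) :
    (Cardinal.lift.{1} (theta lam K κ)).IsRegular := (th_spec hctx hκ).1.lift

theorem th1_pos (hctx : GroundCtx lam mu K) {κ : Cardinal.{0}} (hκ : κ ∈ K) :
    0 < Cardinal.lift.{1} (theta lam K κ) := (th1_reg hctx hκ).pos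

theorem union_lt {α : Type u} {θ : Cardinal.{u}} (h0 : ℵ₀ ≤ θ) {s t : Set α} (hs : #s < θ)
    (ht : #t < θ) : #(s ∪ t : Set α) < θ :=
  (mk_union_le s t).trans_lt (add_lt_of_lt h0 hs ht)

def extC (p q : Cond) : Prop := ∀ i b, p i = some b → q i = some b

theorem extC.dom {p q : Cond} (h : extC p q) : cdom p ⊆ cdom q := by
  intro i hi
  obtain ⟨b, hb⟩ := Option.isSome_iff_exists.1 hi
  exact Option.isSome_iff_exists.2 ⟨b, h i b hb⟩

theorem extC.eq {p q : Cond} (h : extC p q) {i : Ordinal} (hi : i ∈ cdom p) : q i = p i := by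
  obtain ⟨b, hb⟩ := Option.isSome_iff_exists.1 hi
  rw [hb, h i b hb]

theorem extC_of {p q : Cond} (h : ∀ i ∈ cdom p, q i = p i) : extC p q := by
  intro i b hb
  rw [h i (Option.isSome_iff_exists.2 ⟨b, hb⟩), hb]

theorem condLe_refl (hctx : GroundCtx lam mu K) (p : Cond) : condLe lam mu K p p := by
  refine ⟨fun i b h => h, fun κ hκ => ?_⟩
  have : growClasses mu κ (cdom p) (cdom p) = ∅ := by
    ext A; simp [growClasses, grows]
  rw [this]
  simpa using (th_spec hctx hκ).1.pos

theorem condLe_trans (hctx : GroundCtx lam mu K) {p q r : Cond} (h1 : condLe lam mu K p q)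
    (h2 : condLe lam mu K q r) : condLe lam mu K p r := by
  refine ⟨fun i b h => h2.1 i b (h1.1 i b h), fun κ hκ => ?_⟩
  refine (mk_le_mk_of_subset ?_).trans_lt
    (union_lt (th1_reg hctx hκ).aleph0_le (h1.2 κ hκ) (h2.2 κ hκ))
  rintro A ⟨hA, hn, hne⟩
  by_cases h : A ∩ cdom p = A ∩ cdom q
  · right
    exact ⟨hA, h ▸ hn, h ▸ hne⟩
  · left
    exact ⟨hA, hn, h⟩

def pureP (κ : Cardinal.{0}) (p q : Cond) : Prop :=
  ∀ x, (Ecl κ x ∩ cdom p).Nonempty → Ecl κ x ∩ cdom p = Ecl κ x ∩ cdom q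

theorem pureP.down {κ κ' : Cardinal.{0}} (h : κ' ≤ κ) {p q : Cond} (hp : pureP κ p q) :
    pureP κ' p q := by
  intro x hx
  have h1 := hp x (hx.mono (inter_subset_inter_left _ (Ecl_mono_s19 h x)))
  have h2 : Ecl κ' x = Ecl κ' x ∩ Ecl κ x := (inter_eq_left.2 (Ecl_mono_s19 h x)).symm
  rw [h2, inter_assoc, inter_assoc, h1]

theorem pureP.trans {κ : Cardinal.{0}} {p q r : Cond} (h1 : pureP κ p q) (h2 : pureP κ q r) :
    pureP κ p r := by
  intro x hx
  have h := h1 x hx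
  rw [h]
  exact h2 x (h ▸ hx)

theorem classes_meet (κ : Cardinal.{0}) (a : Set Ordinal.{0}) :
    #{A : Set Ordinal.{0} | (∃ i < mu.ord, A = Ecl κ i) ∧ (A ∩ a).Nonempty} ≤ #a := by
  have : {A : Set Ordinal.{0} | (∃ i < mu.ord, A = Ecl κ i) ∧ (A ∩ a).Nonempty} ⊆ Ecl κ '' a := by
    rintro A ⟨⟨i, -, rfl⟩, x, hx, hxa⟩
    exact ⟨x, hxa, (Ecl_eq hx).symm⟩
  exact (mk_le_mk_of_subset this).trans mk_image_le

theorem amalg (hctx : GroundCtx lam mu K) {κ : Cardinal.{0}} (hκ : κ ∈ K) {p q s t : Cond}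
    (hs : inQ lam mu K s) (ht : inQ lam mu K t)
    (hpq : condLe lam mu K p q) (hpure : pureP κ p q)
    (eps : extC p s) (gps : ∀ κ' ∈ K, κ' < κ →
      #↥(growClasses mu κ' (cdom p) (cdom s)) < Cardinal.lift.{1} (theta lam K κ'))
    (eqt : extC q t) (gqt : ∀ κ' ∈ K, κ' < κ →
      #↥(growClasses mu κ' (cdom q) (cdom t)) < Cardinal.lift.{1} (theta lam K κ'))
    (ca : #↥(cdom s \ cdom p) < Cardinal.lift.{1} (theta lam K κ))
    (cb : #↥(cdom t \ cdom q) < Cardinal.lift.{1} (theta lam K κ))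
    (hagr : ∀ x ∈ cdom s \ cdom p, Ecl κ x ∩ cdom p = Ecl κ x ∩ cdom q)
    (hcc : ∀ x ∈ cdom s \ cdom p, ∀ y ∈ cdom t \ cdom q, y ∈ Ecl (theta lam K κ) x →
      ∀ z ∈ Ecl (theta lam K κ) x,
        (z ∈ cdom s \ cdom p ↔ z ∈ cdom t \ cdom q) ∧ (z ∈ cdom s \ cdom p → s z = t z)) :
    compatQ lam mu K s t := by
  have epq : extC p q := hpq.1
  have dpq := epq.dom
  have dps := eps.dom
  have dqt := eqt.dom
  have hdom : cdom (unionC t s) = cdom s ∪ cdom t := by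
    ext x
    simp only [cdom, unionC, mem_ofPred_eq, mem_union]
    cases t x <;> simp
  have er2 : extC t (unionC t s) := by
    intro i b hb
    simp [unionC, hb]
  have er1 : extC s (unionC t s) := by
    apply extC_of
    intro x hx
    by_cases hxt : x ∈ cdom t
    · rw [er2.eq hxt]
      by_cases hxp : x ∈ cdom p
      · rw [eqt.eq (dpq hxp), epq.eq hxp, eps.eq hxp]
      · have hxa : x ∈ cdom s \ cdom p := ⟨hx, hxp⟩
        have hxq : x ∉ cdom q := by
          intro hxq
          have : x ∈ Ecl κ x ∩ cdom p := by
            rw [hagr x hxa]; exact ⟨Ecl_refl _ _, hxq⟩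
          exact hxp this.2
        exact ((hcc x hxa x ⟨hxt, hxq⟩ (Ecl_refl _ _) x (Ecl_refl _ _)).2 hxa).symm
    · have : t x = none := by
        simpa [cdom] using hxt
      simp [unionC, this]
  refine ⟨unionC t s, ⟨?_, ?_⟩, ⟨er1, ?_⟩, ⟨er2, ?_⟩⟩
  · rw [hdom]; exact union_subset hs.1 ht.1
  · intro i hi κ' hκ'
    rw [hdom, inter_union_distrib_left]
    exact union_lt (th1_reg hctx hκ').aleph0_le (hs.2 i hi κ' hκ') (ht.2 i hi κ' hκ')
  · intro κ' hκ'
    have h0 := (th1_reg hctx hκ').aleph0_le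
    rw [hdom]
    rcases le_or_gt κ κ' with hle | hlt
    · have hth : Cardinal.lift.{1} (theta lam K κ) ≤ Cardinal.lift.{1} (theta lam K κ') :=
        lift_le.2 (th_mono hctx hκ' hle)
      refine (mk_le_mk_of_subset ?_).trans_lt (union_lt h0 (hpq.2 κ' hκ')
        (union_lt h0 ((classes_meet (mu := mu) κ' (cdom s \ cdom p)).trans_lt (ca.trans_le hth))
         ((classes_meet (mu := mu) κ' (cdom t \ cdom q)).trans_lt (cb.trans_le hth))))
      rintro A ⟨hA, hn, hne⟩
      by_cases h1 : (A ∩ (cdom s \ cdom p)).Nonempty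
      · exact Or.inr (Or.inl ⟨hA, h1⟩)
      by_cases h2 : (A ∩ (cdom t \ cdom q)).Nonempty
      · exact Or.inr (Or.inr ⟨hA, h2⟩)
      left
      have e1 : A ∩ cdom s = A ∩ cdom p := by
        apply Subset.antisymm
        · rintro x ⟨hxA, hx⟩
          by_contra hxp
          exact h1 ⟨x, hxA, hx, fun h => hxp ⟨hxA, h⟩⟩
        · exact inter_subset_inter_right _ dps
      refine ⟨hA, e1 ▸ hn, ?_⟩
      intro e2
      apply hne
      apply Subset.antisymm
      · exact inter_subset_inter_right _ subset_union_left
      · rintro x ⟨hxA, hx | hx⟩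
        · exact ⟨hxA, hx⟩
        · rw [e1, e2]
          by_contra hxq
          exact h2 ⟨x, hxA, hx, fun h => hxq ⟨hxA, h⟩⟩
    · refine (mk_le_mk_of_subset ?_).trans_lt (gqt κ' hκ' hlt)
      rintro A ⟨⟨i, hi, rfl⟩, ⟨x, hxA, hxs⟩, hne⟩
      have hθ : κ' ≤ theta lam K κ := (th_spec hctx hκ).2.2.2 κ' hκ' hlt
      have hAκ : Ecl κ' i ⊆ Ecl κ x := (Ecl_eq hxA).subset.trans (Ecl_mono_s19 hlt.le x)
      have hAθ : Ecl κ' i ⊆ Ecl (theta lam K κ) x := (Ecl_eq hxA).subset.trans (Ecl_mono_s19 hθ x)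
      have agr : Ecl κ x ∩ cdom p = Ecl κ x ∩ cdom q := by
        by_cases hxp : x ∈ cdom p
        · exact hpure x ⟨x, Ecl_refl _ _, hxp⟩
        · exact hagr x ⟨hxs, hxp⟩
      obtain ⟨y, hyA, hyt, hys⟩ : ∃ y, y ∈ Ecl κ' i ∧ y ∈ cdom t ∧ y ∉ cdom s := by
        by_contra hcon
        push Not at hcon
        apply hne
        apply Subset.antisymm
        · exact inter_subset_inter_right _ subset_union_left
        · rintro z ⟨hzA, hz | hz⟩
          · exact ⟨hzA, hz⟩
          · exact ⟨hzA, hcon z hzA hz⟩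
      have hyq : y ∉ cdom q := by
        intro hyq
        have : y ∈ Ecl κ x ∩ cdom p := by rw [agr]; exact ⟨hAκ hyA, hyq⟩
        exact hys (dps this.2)
      refine ⟨⟨i, hi, rfl⟩, ⟨x, hxA, ?_⟩, ?_⟩
      · by_cases hxp : x ∈ cdom p
        · exact dpq hxp
        · exfalso
          have := (hcc x ⟨hxs, hxp⟩ y ⟨hyt, hyq⟩ (hAθ hyA) y (hAθ hyA)).1.2 ⟨hyt, hyq⟩
          exact hys this.1
      · intro e
        have : y ∈ Ecl κ' i ∩ cdom q := by rw [e]; exact ⟨hyA, hyt⟩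
        exact hyq this.2
  · intro κ' hκ'
    have h0 := (th1_reg hctx hκ').aleph0_le
    rw [hdom]
    have hy' : ∀ A : Set Ordinal.{0}, A ∩ cdom t ≠ A ∩ (cdom s ∪ cdom t) →
        ∃ y, y ∈ A ∧ y ∈ cdom s ∧ y ∉ cdom t := by
      intro A hne
      by_contra hcon
      push Not at hcon
      apply hne
      apply Subset.antisymm
      · exact inter_subset_inter_right _ subset_union_right
      · rintro z ⟨hzA, hz | hz⟩
        · exact ⟨hzA, hcon z hzA hz⟩
        · exact ⟨hzA, hz⟩
    rcases le_or_gt κ κ' with hle | hlt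
    · have hth : Cardinal.lift.{1} (theta lam K κ) ≤ Cardinal.lift.{1} (theta lam K κ') :=
        lift_le.2 (th_mono hctx hκ' hle)
      refine (mk_le_mk_of_subset ?_).trans_lt
        ((classes_meet (mu := mu) κ' (cdom s \ cdom p)).trans_lt (ca.trans_le hth))
      rintro A ⟨hA, hn, hne⟩
      obtain ⟨y, hyA, hys, hyt⟩ := hy' A hne
      exact ⟨hA, y, hyA, hys, fun h => hyt (dqt (dpq h))⟩
    · refine (mk_le_mk_of_subset ?_).trans_lt (gps κ' hκ' hlt)
      rintro A ⟨⟨i, hi, rfl⟩, ⟨x, hxA, hxt⟩, hne⟩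
      obtain ⟨y, hyA, hys, hyt⟩ := hy' _ hne
      have hyp : y ∉ cdom p := fun h => hyt (dqt (dpq h))
      have hθ : κ' ≤ theta lam K κ := (th_spec hctx hκ).2.2.2 κ' hκ' hlt
      have hAκ : Ecl κ' i ⊆ Ecl κ y := (Ecl_eq hyA).subset.trans (Ecl_mono_s19 hlt.le y)
      have hAθ : Ecl κ' i ⊆ Ecl (theta lam K κ) y := (Ecl_eq hyA).subset.trans (Ecl_mono_s19 hθ y)
      have agr := hagr y ⟨hys, hyp⟩
      refine ⟨⟨i, hi, rfl⟩, ⟨x, hxA, ?_⟩, ?_⟩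
      · by_cases hxq : x ∈ cdom q
        · have : x ∈ Ecl κ y ∩ cdom p := by rw [agr]; exact ⟨hAκ hxA, hxq⟩
          exact this.2
        · exfalso
          have := (hcc y ⟨hys, hyp⟩ x ⟨hxt, hxq⟩ (hAθ hxA) y (Ecl_refl _ _)).1.1 ⟨hys, hyp⟩
          exact hyt this.1
      · intro e
        have : y ∈ Ecl κ' i ∩ cdom p := by rw [e]; exact ⟨hyA, hys⟩
        exact hyp this.2

theorem unionFam_spec {f : Ordinal.{0} → Cond} {δ : Ordinal.{0}}
    (hle : ∀ i j : Ordinal, i ≤ j → j < δ → extC (f i) (f j)) :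
    cdom (unionFam f δ) = ⋃ i : Iio δ, cdom (f i.1) ∧ ∀ i < δ, extC (f i) (unionFam f δ) := by
  have h2 : ∀ i < δ, extC (f i) (unionFam f δ) := by
    intro i hi x b hb
    have hex : ∃ i, i < δ ∧ (f i x).isSome := ⟨i, hi, by simp [hb]⟩
    have e : unionFam f δ x = f hex.choose x := by simp only [unionFam]; exact dif_pos hex
    rw [e]
    have hc := hex.choose_spec
    rcases le_total i hex.choose with h | h
    · exact hle _ _ h hc.1 x b hb
    · rw [← (hle _ _ h hi).eq hc.2, hb]
  refine ⟨?_, h2⟩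
  apply Subset.antisymm
  · intro x hx
    by_cases hex : ∃ i, i < δ ∧ (f i x).isSome
    · obtain ⟨i, hi, h⟩ := hex
      exact mem_iUnion.2 ⟨⟨i, hi⟩, h⟩
    · have e : unionFam f δ x = none := by simp only [unionFam]; exact dif_neg hex
      simp [cdom, e] at hx
  · apply iUnion_subset
    rintro ⟨i, hi⟩
    exact (h2 i hi).dom

theorem union_pure {κ : Cardinal.{0}} {f : Ordinal.{0} → Cond} {δ : Ordinal.{0}}
    (hle : ∀ i j : Ordinal, i ≤ j → j < δ → extC (f i) (f j))
    (hp : ∀ i j : Ordinal, i ≤ j → j < δ → pureP κ (f i) (f j)) :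
    ∀ i < δ, pureP κ (f i) (unionFam f δ) := by
  obtain ⟨hd, he⟩ := unionFam_spec hle
  intro i hi x hx
  apply Subset.antisymm
  · exact inter_subset_inter_right _ (he i hi).dom
  · rintro y ⟨hyx, hy⟩
    rw [hd, mem_iUnion] at hy
    obtain ⟨⟨j, hj⟩, hy⟩ := hy
    rcases le_total i j with h | h
    · rw [hp i j h hj x hx]; exact ⟨hyx, hy⟩
    · exact ⟨hyx, (hle j i h hi).dom hy⟩

theorem union_ok (hctx : GroundCtx lam mu K) {f : Ordinal.{0} → Cond} {δ : Ordinal.{0}}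
    (hQ : ∀ i < δ, inQ lam mu K (f i))
    (hle : ∀ i j : Ordinal, i ≤ j → j < δ → condLe lam mu K (f i) (f j))
    (hc : ∀ κ ∈ K, δ.card < theta lam K κ ∨
      ∀ i j : Ordinal, i ≤ j → j < δ → pureP κ (f i) (f j)) :
    inQ lam mu K (unionFam f δ) ∧ ∀ i < δ, condLe lam mu K (f i) (unionFam f δ) := by
  have hle' : ∀ i j : Ordinal, i ≤ j → j < δ → extC (f i) (f j) := fun i j h1 h2 => (hle i j h1 h2).1
  obtain ⟨hd, he⟩ := unionFam_spec hle'
  have hsm : ∀ κ, δ.card < theta lam K κ → #(Iio δ) < Cardinal.lift.{1} (theta lam K κ) := by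
    intro κ h
    rw [mk_Iio_ordinal]
    exact lift_lt.2 h
  refine ⟨⟨?_, ?_⟩, ?_⟩
  · rw [hd]
    exact iUnion_subset fun i => (hQ i.1 i.2).1
  · intro x hx κ hκ
    rcases hc κ hκ with h | h
    · rw [hd, inter_iUnion, card_iUnion_lt_iff_forall_of_isRegular (th1_reg hctx hκ) (hsm κ h)]
      exact fun i => (hQ i.1 i.2).2 x hx κ hκ
    · by_cases hex : ∃ i, i < δ ∧ (Ecl κ x ∩ cdom (f i)).Nonempty
      · obtain ⟨i, hi, hn⟩ := hex
        rw [← union_pure hle' h i hi x hn]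
        exact (hQ i hi).2 x hx κ hκ
      · have : Ecl κ x ∩ cdom (unionFam f δ) = ∅ := by
          rw [hd, inter_iUnion]
          rw [iUnion_eq_empty]
          rintro ⟨i, hi⟩
          by_contra hne
          exact hex ⟨i, hi, nonempty_iff_ne_empty.2 hne⟩
        rw [this]
        simpa using (th_spec hctx hκ).1.pos
  · intro i hi
    refine ⟨he i hi, fun κ hκ => ?_⟩
    rcases hc κ hκ with h | h
    · have hlt : #(⋃ j : Iio δ, if i ≤ j.1 then growClasses mu κ (cdom (f i)) (cdom (f j.1)) else ∅ :
          Set (Set Ordinal.{0})) < Cardinal.lift.{1} (theta lam K κ) := by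
        rw [card_iUnion_lt_iff_forall_of_isRegular (th1_reg hctx hκ) (hsm κ h)]
        rintro ⟨j, hj⟩
        dsimp only
        split_ifs with hij
        · exact (hle i j hij hj).2 κ hκ
        · simpa using (th_spec hctx hκ).1.pos
      refine (mk_le_mk_of_subset ?_).trans_lt hlt
      rintro A ⟨hA, hn, hne⟩
      by_contra hcon
      apply hne
      apply Subset.antisymm
      · exact inter_subset_inter_right _ (he i hi).dom
      · rintro y ⟨hyA, hy⟩
        rw [hd, mem_iUnion] at hy
        obtain ⟨⟨j, hj⟩, hy⟩ := hy
        rcases le_total i j with hij | hij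
        · by_contra hyi
          apply hcon
          refine mem_iUnion.2 ⟨⟨j, hj⟩, ?_⟩
          dsimp only
          rw [if_pos hij]
          refine ⟨hA, hn, fun e => hyi ?_⟩
          rw [e]; exact ⟨hyA, hy⟩
        · exact ⟨hyA, (hle' j i hij hi).dom hy⟩
    · have : growClasses mu κ (cdom (f i)) (cdom (unionFam f δ)) = ∅ := by
        rw [eq_empty_iff_forall_notMem]
        rintro A ⟨⟨x, -, rfl⟩, hn, hne⟩
        exact hne (union_pure hle' h i hi x hn)
      rw [this]
      simpa using (th_spec hctx hκ).1.pos

end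


section
variable {lam mu : Cardinal.{0}} {K : Set Cardinal.{0}}

theorem pure_step (hctx : GroundCtx lam mu K) {κ : Cardinal.{0}} (hκ : κ ∈ K) {v r : Cond}
    (hr : inQ lam mu K r) (h : condLe lam mu K v r) :
    ∃ p, inQ lam mu K p ∧ condLe lam mu K v p ∧ pureP κ v p ∧ extC p r ∧
      (∀ κ' ∈ K, κ' < κ →
        #↥(growClasses mu κ' (cdom p) (cdom r)) < Cardinal.lift.{1} (theta lam K κ')) ∧
      #↥(cdom r \ cdom p) < Cardinal.lift.{1} (theta lam K κ) ∧
      ∀ x ∈ cdom r \ cdom p, (Ecl κ x ∩ cdom p).Nonempty := by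
  have evr : extC v r := h.1
  have dvr := evr.dom
  let X : Set Ordinal.{0} := cdom v ∪ {x | ¬ (Ecl κ x ∩ cdom v).Nonempty}
  have hd : cdom (restrictC r X) = cdom r ∩ X := by
    ext x
    by_cases hx : x ∈ X <;> simp [cdom, restrictC, hx]
  have epr : extC (restrictC r X) r := by
    intro x b hb
    by_cases hx : x ∈ X
    · simpa [restrictC, hx] using hb
    · simp [restrictC, hx] at hb
  have evp : extC v (restrictC r X) := by
    intro x b hb
    have hx : x ∈ X := Or.inl (Option.isSome_iff_exists.2 ⟨b, hb⟩)
    simpa [restrictC, hx] using evr x b hb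
  have dvp := evp.dom
  have dpr := epr.dom
  have hout : ∀ x ∈ cdom r \ cdom (restrictC r X), x ∉ cdom v ∧ (Ecl κ x ∩ cdom v).Nonempty := by
    rintro x ⟨hx, hxp⟩
    have hxX : x ∉ X := fun h => hxp (by rw [hd]; exact ⟨hx, h⟩)
    refine ⟨fun h => hxX (Or.inl h), ?_⟩
    by_contra hn
    exact hxX (Or.inr hn)
  have hpure : pureP κ v (restrictC r X) := by
    intro x hx
    apply Subset.antisymm
    · exact inter_subset_inter_right _ dvp
    · rintro y ⟨hyx, hy⟩
      rw [hd] at hy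
      rcases hy.2 with h1 | h1
      · exact ⟨hyx, h1⟩
      · exfalso
        apply h1
        rw [← Ecl_eq hyx]
        exact hx
  refine ⟨restrictC r X, ⟨dpr.trans hr.1, ?_⟩, ⟨evp, ?_⟩, hpure, epr, ?_, ?_, ?_⟩
  · intro i hi κ' hκ'
    exact (mk_le_mk_of_subset (inter_subset_inter_right _ dpr)).trans_lt (hr.2 i hi κ' hκ')
  · intro κ' hκ'
    refine (mk_le_mk_of_subset ?_).trans_lt (h.2 κ' hκ')
    rintro A ⟨hA, hn, hne⟩
    refine ⟨hA, hn, fun e => hne ?_⟩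
    apply Subset.antisymm
    · exact inter_subset_inter_right _ dvp
    · rw [e]; exact inter_subset_inter_right _ dpr
  · intro κ' hκ' hlt
    refine (mk_le_mk_of_subset ?_).trans_lt (h.2 κ' hκ')
    rintro A ⟨⟨i, hi, rfl⟩, ⟨x, hxA, hx⟩, hne⟩
    obtain ⟨y, hyA, hyr, hyp⟩ : ∃ y, y ∈ Ecl κ' i ∧ y ∈ cdom r ∧ y ∉ cdom (restrictC r X) := by
      by_contra hcon
      push Not at hcon
      apply hne
      apply Subset.antisymm
      · exact inter_subset_inter_right _ dpr
      · rintro z ⟨hz, hz'⟩; exact ⟨hz, hcon z hz hz'⟩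
    obtain ⟨h1, h2⟩ := hout y ⟨hyr, hyp⟩
    have hxy : x ∈ Ecl κ y := Ecl_mono_s19 hlt.le y ((Ecl_eq hyA).subset hxA)
    have hxv : x ∈ Ecl κ y ∩ cdom v := by rw [hpure y h2]; exact ⟨hxy, hx⟩
    refine ⟨⟨i, hi, rfl⟩, ⟨x, hxA, hxv.2⟩, fun e => h1 ?_⟩
    have : y ∈ Ecl κ' i ∩ cdom v := by rw [e]; exact ⟨hyA, hyr⟩
    exact this.2
  · have hlt : #(⋃ A : growClasses mu κ (cdom v) (cdom r), A.1 ∩ cdom r : Set Ordinal.{0}) <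
        Cardinal.lift.{1} (theta lam K κ) := by
      rw [card_iUnion_lt_iff_forall_of_isRegular (th1_reg hctx hκ) (h.2 κ hκ)]
      rintro ⟨A, ⟨i, hi, rfl⟩, hA⟩
      exact hr.2 i hi κ hκ
    refine (mk_le_mk_of_subset ?_).trans_lt hlt
    intro x hx
    obtain ⟨h1, h2⟩ := hout x hx
    refine mem_iUnion.2 ⟨⟨Ecl κ x, ⟨x, hr.1 hx.1, rfl⟩, h2, fun e => h1 ?_⟩, Ecl_refl _ _, hx.1⟩
    have : x ∈ Ecl κ x ∩ cdom v := by rw [e]; exact ⟨Ecl_refl _ _, hx.1⟩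
    exact this.2
  · intro x hx
    exact (hout x hx).2.mono (inter_subset_inter_right _ dvp)

def PR (lam mu : Cardinal.{0}) (K : Set Cardinal.{0}) (κ : Cardinal.{0}) (p q : Cond) : Prop :=
  inQ lam mu K p ∧ inQ lam mu K q ∧ condLe lam mu K p q ∧ pureP κ p q

theorem PR_refl (hctx : GroundCtx lam mu K) {κ : Cardinal.{0}} {p : Cond} (hp : inQ lam mu K p) :
    PR lam mu K κ p p := ⟨hp, hp, condLe_refl hctx p, fun _ _ => rfl⟩

theorem PR_trans (hctx : GroundCtx lam mu K) {κ : Cardinal.{0}} {p q r : Cond}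
    (h1 : PR lam mu K κ p q) (h2 : PR lam mu K κ q r) : PR lam mu K κ p r :=
  ⟨h1.1, h2.2.1, condLe_trans hctx h1.2.2.1 h2.2.2.1, h1.2.2.2.trans h2.2.2.2⟩

theorem PR_bound (hctx : GroundCtx lam mu K) {κ : Cardinal.{0}} (hκ : κ ∈ K) {p0 : Cond}
    (hp0 : inQ lam mu K p0) {δ : Ordinal.{0}} (hδ : δ < κ.ord) (f : Ordinal.{0} → Cond)
    (h0 : ∀ i < δ, PR lam mu K κ p0 (f i))
    (h1 : ∀ i j, i < j → j < δ → PR lam mu K κ (f i) (f j)) :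
    ∃ v, PR lam mu K κ p0 v ∧ ∀ i < δ, PR lam mu K κ (f i) v := by
  rcases eq_or_ne δ 0 with rfl | hne
  · exact ⟨p0, PR_refl hctx hp0, fun i hi => absurd hi (by simp)⟩
  have hpos : 0 < δ := pos_iff_ne_zero.2 hne
  have h2 : ∀ i j, i ≤ j → j < δ → PR lam mu K κ (f i) (f j) := by
    intro i j hij hj
    rcases hij.eq_or_lt with rfl | h
    · exact PR_refl hctx (h0 i hj).2.1
    · exact h1 i j h hj
  obtain ⟨hu1, hu2⟩ := union_ok hctx (f := f) (δ := δ) (fun i hi => (h0 i hi).2.1)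
    (fun i j hij hj => (h2 i j hij hj).2.2.1) (by
      intro κ' hκ'
      rcases le_or_gt κ' κ with h | h
      · right
        intro i j hij hj
        exact (h2 i j hij hj).2.2.2.down h
      · left
        exact (lt_ord.1 hδ).trans_le ((th_spec hctx hκ').2.2.2 κ hκ h))
  have hu3 := union_pure (κ := κ) (f := f) (δ := δ) (fun i j hij hj => (h2 i j hij hj).2.2.1.1)
    (fun i j hij hj => (h2 i j hij hj).2.2.2)
  have hv : ∀ i < δ, PR lam mu K κ (f i) (unionFam f δ) := fun i hi =>
    ⟨(h0 i hi).2.1, hu1, hu2 i hi, hu3 i hi⟩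
  exact ⟨unionFam f δ, PR_trans hctx (h0 0 hpos) (hv 0 hpos), hv⟩

theorem odom_ores (s : Cond) (Y : Set Ordinal.{0}) : odom (ores s Yᶜ) = cdom s \ Y := by
  ext x
  by_cases h : x ∈ Y <;> simp [odom, ores, cdom, h]

theorem hcc_of {s t : Cond} {Y Z : Set Ordinal.{0}} {z : Ordinal.{0}}
    (h : ores s Yᶜ z = ores t Zᶜ z) :
    (z ∈ cdom s \ Y ↔ z ∈ cdom t \ Z) ∧ (z ∈ cdom s \ Y → s z = t z) := by
  have h1 : z ∈ cdom s \ Y ↔ z ∈ cdom t \ Z := by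
    rw [← odom_ores, ← odom_ores]
    show (ores s Yᶜ z).isSome ↔ (ores t Zᶜ z).isSome
    rw [h]
  refine ⟨h1, fun h2 => ?_⟩
  have h3 := h1.1 h2
  simpa [ores, h2.2, h3.2] using h

/-- The chain condition in the form used twice. -/
theorem cc_main (hctx : GroundCtx lam mu K)
    (hGCH : ∀ θc : Cardinal, lam ≤ θc → θc ≤ mu → (2 : Cardinal) ^ θc = Order.succ θc)
    {κ : Cardinal.{0}} (hκ : κ ∈ K) (Δ : Ordinal.{0}) (hΔ : theta lam K κ < Δ.card)
    (p s : Ordinal.{0} → Cond)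
    (hc : ∀ i < Δ, #↥(cdom (s i) \ cdom (p i)) < Cardinal.lift.{1} (theta lam K κ)) :
    ∃ i j, i < j ∧ j < Δ ∧ ∀ x ∈ cdom (s i) \ cdom (p i), ∀ y ∈ cdom (s j) \ cdom (p j),
      y ∈ Ecl (theta lam K κ) x → ∀ z ∈ Ecl (theta lam K κ) x,
        (z ∈ cdom (s i) \ cdom (p i) ↔ z ∈ cdom (s j) \ cdom (p j)) ∧
        (z ∈ cdom (s i) \ cdom (p i) → s i z = s j z) := by
  obtain ⟨t1, t2, t3, t4⟩ := th_spec hctx hκ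
  have hpw := pow_le_lift (pow_le_gen hctx hGCH t1 t2 (t3.trans (hctx.2.2.2.2.1 κ hκ).2.2))
  have he : Equivalence (fun x y : Ordinal.{0} => y ∈ Ecl (theta lam K κ) x) :=
    ⟨fun x => rfl, fun {x y} h => Eq.symm h, fun {x y z} h1 h2 => Eq.trans h2 h1⟩
  obtain ⟨i, j, hij, H⟩ := aux_cc (X := Ordinal.{0}) (I := Iio Δ) t1.lift hpw _ he
    (fun x => Ecl_card t1.pos x) (fun i => ores (s i.1) (cdom (p i.1))ᶜ)
    (fun i => by rw [odom_ores]; exact hc i.1 i.2)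
    (by rw [mk_Iio_ordinal]; exact lift_lt.2 hΔ)
  simp only [odom_ores] at H
  rcases lt_or_gt_of_ne hij with h | h
  · refine ⟨i.1, j.1, h, j.2, ?_⟩
    intro x hx y hy hxy z hz
    exact hcc_of (H x hx y hy hxy z hz)
  · refine ⟨j.1, i.1, h, i.2, ?_⟩
    intro x hx y hy hxy z hz
    exact hcc_of (H y hy x hx (he.symm hxy) z (he.trans (he.symm hxy) hz)).symm

theorem decision (hctx : GroundCtx lam mu K)
    (hGCH : ∀ θc : Cardinal, lam ≤ θc → θc ≤ mu → (2 : Cardinal) ^ θc = Order.succ θc)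
    {κ : Cardinal.{0}} (hκ : κ ∈ K) (hlt : theta lam K κ < κ) (p0 : Cond)
    (hp0 : inQ lam mu K p0) (N : Cond → Ordinal.{0} → Prop)
    (hN1 : ∀ r r' β, N r β → inQ lam mu K r' → condLe lam mu K r r' → N r' β)
    (hN2 : ∀ r β β', N r β → N r β' → β = β') :
    ∃ q, PR lam mu K κ p0 q ∧ ∃ B : Set Ordinal.{0}, #B ≤ Cardinal.lift.{1} (theta lam K κ) ∧
      ∀ r, inQ lam mu K r → condLe lam mu K q r → ∀ β, N r β → β ∈ B := by
  by_contra hcon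
  push Not at hcon
  set θ := theta lam K κ with hθdef
  let Δ := (Order.succ θ).ord
  have hΔκ : ∀ i < Δ, i < κ.ord := fun i hi =>
    hi.trans_le (ord_le_ord.2 (Order.succ_le_of_lt hlt))
  obtain ⟨f, w, hfw⟩ := aux_seq (P := Cond × Cond × Ordinal.{0}) (O := Ordinal.{0})
    (fun x y => PR lam mu K κ x.1 y.1) (fun x y z h1 h2 => PR_trans hctx h1 h2) (p0, p0, 0)
    (Iio Δ) (fun i hi j hj => lt_trans hj hi)
    (by
      intro δ hδ f h0 h1
      obtain ⟨v, hv1, hv2⟩ := PR_bound hctx hκ hp0 (hΔκ δ hδ) (fun i => (f i).1) h0 h1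
      exact ⟨(v, p0, 0), hv1, hv2⟩)
    (fun h i v f => extC f.1 f.2.1 ∧ (∀ κ' ∈ K, κ' < κ →
        #↥(growClasses mu κ' (cdom f.1) (cdom f.2.1)) < Cardinal.lift.{1} (theta lam K κ')) ∧
      #↥(cdom f.2.1 \ cdom f.1) < Cardinal.lift.{1} (theta lam K κ) ∧
      (∀ x ∈ cdom f.2.1 \ cdom f.1, (Ecl κ x ∩ cdom f.1).Nonempty) ∧
      inQ lam mu K f.2.1 ∧ N f.2.1 f.2.2 ∧ ∀ j < i, f.2.2 ≠ (h j).2.2)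
    (by
      intro h i hi v hv
      obtain ⟨r, hr, hvr, β, hβ, hβB⟩ := hcon v.1 hv ((fun j => (h j).2.2) '' Iio i) (by
        refine mk_image_le.trans ?_
        rw [mk_Iio_ordinal]
        exact lift_le.2 (Order.lt_succ_iff.1 (lt_ord.1 hi)))
      obtain ⟨p, a1, a2, a3, a4, a5, a6, a7⟩ := pure_step hctx hκ hr hvr
      refine ⟨(p, r, β), ⟨hv.2.1, a1, a2, a3⟩, a4, a5, a6, a7, hr, hβ, ?_⟩
      intro j hj e
      exact hβB ⟨j, hj, e.symm⟩)
  obtain ⟨i, j, hij, hj, H⟩ := cc_main hctx hGCH hκ Δ (by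
      simp only [Δ, card_ord]; exact Order.lt_succ _) (fun i => (f i).1) (fun i => (f i).2.1)
    (fun i hi => by
      obtain ⟨-, -, -, h, -, hS⟩ := hfw i hi
      exact hS.2.2.1)
  have hi : i < Δ := hij.trans hj
  obtain ⟨-, -, -, -, -, b1, b2, b3, b4, b5, b6, -⟩ := hfw i hi
  obtain ⟨-, c1, c2, h, hh, d1, d2, d3, d4, d5, d6, d7⟩ := hfw j hj
  have hpr := PR_trans hctx (c2 i hij) c1
  obtain ⟨r, hr, hr1, hr2⟩ := amalg hctx hκ b5 d5 hpr.2.2.1 hpr.2.2.2 b1 b2 d1 d2 b3 d3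
    (fun x hx => hpr.2.2.2 x (b4 x hx)) H
  have e := hN2 r _ _ (hN1 _ _ _ b6 hr hr1) (hN1 _ _ _ d6 hr hr2)
  have hne := d7 i hij
  rw [hh i hij] at hne
  exact hne e.symm

end

section

variable {lam mu : Cardinal.{0}} {K : Set Cardinal.{0}}

theorem dom_small (hctx : GroundCtx lam mu K) {q : Cond} (hq : inQ lam mu K q) :
    #↥(cdom q) < Cardinal.lift.{1} (theta lam K mu) := by
  have hm := hctx.2.2.1
  have hmK := hctx.2.2.2.2.2.2
  have hpr : Ordinal.IsPrincipal (· + ·) mu.ord := Ordinal.isPrincipal_add_ord hm.aleph0_le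
  have h := hq.2 0 (by
    rw [lt_ord]; simpa using hm.pos) mu hmK
  refine lt_of_le_of_lt (mk_le_mk_of_subset ?_) h
  intro x hx
  refine ⟨?_, hx⟩
  change x + mu.ord = 0 + mu.ord
  rw [zero_add]
  exact hpr.add_eq_right (hq.1 hx)

theorem claim_card (hctx : GroundCtx lam mu K)
    (hGCH : ∀ θc : Cardinal, lam ≤ θc → θc ≤ mu → (2 : Cardinal) ^ θc = Order.succ θc) :
    #↥{q : Cond | inQ lam mu K q} = Cardinal.lift.{1} mu := by
  have hm := hctx.2.2.1
  have hmK := hctx.2.2.2.2.2.2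
  apply le_antisymm
  · have hpw := pow_le_lift (pow_le_gen hctx hGCH hm (lam_lt_mu hctx).le le_rfl)
    have := aux_count (X := Ordinal.{0}) (θ := Cardinal.lift.{1} mu) hm.lift.aleph0_le hpw
      (Iio mu.ord) (by rw [mk_Iio_ordinal, card_ord])
    refine le_trans (mk_le_mk_of_subset ?_) this
    intro q hq
    refine ⟨hq.1, ?_⟩
    exact (dom_small hctx hq).trans_le (lift_le.2 (th_spec hctx hmK).2.2.1)
  · have e : #↥(Iio mu.ord) = Cardinal.lift.{1} mu := by rw [mk_Iio_ordinal, card_ord]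
    rw [← e]
    let g : Ordinal.{0} → Cond := fun i j => if j = i then some true else none
    have hg : ∀ i, cdom (g i) = {i} := by
      intro i
      ext j
      by_cases hj : j = i <;> simp [cdom, g, hj]
    refine mk_le_of_injective (f := fun i : Iio mu.ord => (⟨g i.1, ?_, ?_⟩ : {q : Cond | inQ lam mu K q})) ?_
    · rw [hg]
      exact singleton_subset_iff.2 i.2
    · intro k hk κ hκ
      rw [hg]
      refine lt_of_le_of_lt (mk_le_mk_of_subset inter_subset_right) ?_
      rw [mk_singleton]
      exact one_lt_aleph0.trans_le (th1_reg hctx hκ).aleph0_le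
    · intro i j hij
      have h1 : g i.1 = g j.1 := congrArg Subtype.val hij
      have h2 : ({i.1} : Set Ordinal.{0}) = {j.1} := by rw [← hg, ← hg, h1]
      exact Subtype.ext (singleton_eq_singleton_iff.1 h2)

theorem claim_pow (hctx : GroundCtx lam mu K)
    (hGCH : ∀ θc : Cardinal, lam ≤ θc → θc ≤ mu → (2 : Cardinal) ^ θc = Order.succ θc) :
    2 ^< theta lam K mu ≤ mu := by
  obtain ⟨t1, t2, t3, t4⟩ := th_spec hctx hctx.2.2.2.2.2.2
  rw [powerlt_le]
  intro ν hν
  have h2 : (2 : Cardinal) ≤ theta lam K mu := (natCast_lt_aleph0 (n := 2)).le.trans t1.aleph0_le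
  exact (power_le_power_right h2).trans ((pow_le_gen hctx hGCH t1 t2 t3 ν hν).trans t3)

theorem th_le_powerlt (θ : Cardinal.{0}) : θ ≤ 2 ^< θ := by
  by_contra h
  rw [not_le] at h
  exact absurd (le_powerlt 2 h) (not_le.2 (cantor _))

theorem claim_cc (hctx : GroundCtx lam mu K)
    (hGCH : ∀ θc : Cardinal, lam ≤ θc → θc ≤ mu → (2 : Cardinal) ^ θc = Order.succ θc)
    (f : Ordinal.{0} → Cond)
    (hf : ∀ i < (Order.succ (2 ^< theta lam K mu)).ord, inQ lam mu K (f i)) :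
    ∃ i j : Ordinal, i < (Order.succ (2 ^< theta lam K mu)).ord ∧
        j < (Order.succ (2 ^< theta lam K mu)).ord ∧ i ≠ j ∧
        compatQ lam mu K (f i) (f j) := by
  have hmK := hctx.2.2.2.2.2.2
  let e : Cond := fun _ => none
  have he : cdom e = ∅ := by ext x; simp [cdom, e]
  have hge : ∀ κ ∈ K, ∀ Y, #↥(growClasses mu κ (cdom e) Y) < Cardinal.lift.{1} (theta lam K κ) := by
    intro κ hκ Y
    have : growClasses mu κ (cdom e) Y = ∅ := by
      rw [he]
      ext A
      simp [growClasses, grows]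
    rw [this, mk_emptyCollection]
    exact th1_pos hctx hκ
  have hex : ∀ s, extC e s := by
    intro s i b h
    simp [e] at h
  have hd : ∀ i < (Order.succ (2 ^< theta lam K mu)).ord,
      #↥(cdom (f i) \ cdom e) < Cardinal.lift.{1} (theta lam K mu) := by
    intro i hi
    exact lt_of_le_of_lt (mk_le_mk_of_subset diff_subset) (dom_small hctx (hf i hi))
  obtain ⟨i, j, hij, hj, H⟩ := cc_main hctx hGCH hmK (Order.succ (2 ^< theta lam K mu)).ord (by
    rw [card_ord]; exact Order.lt_succ_of_le (th_le_powerlt _)) (fun _ => e) f hd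
  have hi := hij.trans hj
  exact ⟨i, j, hi, hj, hij.ne, amalg hctx hmK (p := e) (q := e) (hf i hi) (hf j hj)
    (condLe_refl hctx e) (fun x _ => rfl) (hex _) (fun κ hκ _ => hge κ hκ _) (hex _)
    (fun κ hκ _ => hge κ hκ _) (hd i hi) (hd j hj) (fun x _ => rfl) H⟩

theorem claim_cof (hctx : GroundCtx lam mu K)
    (hGCH : ∀ θc : Cardinal, lam ≤ θc → θc ≤ mu → (2 : Cardinal) ^ θc = Order.succ θc)
    (τ σc : Cardinal.{0}) (hτ : τ.IsRegular) (hσ : σc.IsRegular) (hlτ : lam ≤ τ) (hτσ : τ < σc)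
    (hσm : σc ≤ mu) (q₀ : Cond) (hq₀ : inQ lam mu K q₀)
    (valName : Ordinal.{0} → Cond → Ordinal.{0} → Prop)
    (hv1 : ∀ α r r' β, valName α r β → inQ lam mu K r' → condLe lam mu K r r' →
          valName α r' β)
    (hv2 : ∀ α r β β', valName α r β → valName α r β' → β = β')
    (hv3 : ∀ α r β, valName α r β → β < σc.ord)
    (hcof : ∀ γ, γ < σc.ord → ∀ q, inQ lam mu K q → condLe lam mu K q₀ q →
            ∃ r, inQ lam mu K r ∧ condLe lam mu K q r ∧
              ∃ α, α < τ.ord ∧ ∃ β, γ ≤ β ∧ valName α r β) : False := by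
  have hmK := hctx.2.2.2.2.2.2
  obtain ⟨κ, ⟨hκ, hτκ⟩, hmin⟩ : ∃ κ, (κ ∈ K ∧ τ < κ) ∧ ∀ κ' ∈ K, κ' < κ → κ' ≤ τ := by
    have hne : {κ | κ ∈ K ∧ τ < κ}.Nonempty := ⟨mu, hmK, hτσ.trans_le hσm⟩
    refine ⟨sInf {κ | κ ∈ K ∧ τ < κ}, csInf_mem hne, ?_⟩
    intro κ' h1 h2
    by_contra h3
    exact notMem_of_lt_csInf' h2 ⟨h1, not_le.1 h3⟩
  have hθτ : theta lam K κ ≤ τ := th_le hτ hlτ hmin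
  obtain ⟨f, w, hfw⟩ := aux_seq (P := Cond) (O := Ordinal.{0}) (PR lam mu K κ)
    (fun x y z h1 h2 => PR_trans hctx h1 h2) q₀ (Iio κ.ord) (fun i hi j hj => lt_trans hj hi)
    (fun δ hδ f h0 h1 => PR_bound hctx hκ hq₀ hδ f h0 h1)
    (fun _ α _ q => ∃ B : Set Ordinal.{0}, #B ≤ Cardinal.lift.{1} (theta lam K κ) ∧
      ∀ r, inQ lam mu K r → condLe lam mu K q r → ∀ β, valName α r β → β ∈ B)
    (fun _ α _ p hp => decision hctx hGCH hκ (hθτ.trans_lt hτκ) p hp.2.1 (valName α) (hv1 α) (hv2 α))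
  have hτo : τ.ord < κ.ord := ord_lt_ord.2 hτκ
  obtain ⟨a1, -, a3, -⟩ := hfw τ.ord hτo
  have hB : ∀ α : Iio τ.ord, ∃ B : Set Ordinal.{0}, #B ≤ Cardinal.lift.{1} (theta lam K κ) ∧
      ∀ r, inQ lam mu K r → condLe lam mu K (f α.1) r → ∀ β, valName α.1 r β → β ∈ B := by
    intro α
    obtain ⟨-, -, -, -, -, h⟩ := hfw α.1 (lt_trans α.2 hτo)
    exact h
  choose B hB1 hB2 using hB
  let s : Set Ordinal.{0} := (⋃ α : Iio τ.ord, B α) ∩ Iio σc.ord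
  have hs : #s ≤ Cardinal.lift.{1} τ := by
    refine (mk_le_mk_of_subset inter_subset_left).trans ?_
    refine aux_iUnion_le hτ.lift.aleph0_le B ?_ ?_
    · rw [mk_Iio_ordinal, card_ord]
    · exact fun α => (hB1 α).trans (lift_le.2 hθτ)
  have hγ : sSup ((· + 1) '' s) < σc.ord := by
    apply Ordinal.sSup_add_one_lt_of_lt_cof
    · rw [← Ordinal.lift_cof, hσ.cof_ord]
      exact hs.trans_lt (lift_lt.2 hτσ)
    · exact fun x hx => hx.2
  obtain ⟨r, hr, hqr, α, hα, β, hβ, hval⟩ := hcof _ hγ (w τ.ord) a1.2.1 a1.2.2.1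
  have hβs : β ∈ s := ⟨mem_iUnion.2 ⟨⟨α, hα⟩, hB2 ⟨α, hα⟩ r hr
    (condLe_trans hctx (a3 α hα).2.2.1 hqr) β hval⟩, hv3 α r β hval⟩
  have hbd : BddAbove ((· + 1) '' s) := by
    refine ⟨σc.ord, ?_⟩
    rintro _ ⟨x, hx, rfl⟩
    exact Order.add_one_le_of_lt hx.2
  have h1 : β + 1 ≤ sSup ((· + 1) '' s) := le_csSup hbd ⟨β, hβs, rfl⟩
  exact absurd (h1.trans hβ) (not_le.2 (Order.lt_add_one_iff.2 le_rfl))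

end

/-- assuming GCH on `[λ, μ]`: `Q` has cardinality `μ`, `2^{<θ_μ} ≤ μ`,
`Q` is `λ`-complete (so adds no new `< λ`-sequences), `Q` has the `(2^{<θ_μ})⁺`-c.c.,
and for regular `λ ≤ τ < σ ≤ μ` no condition forces `cf σ = τ` (coded via an abstract
name `valName` for a cofinal function from `τ` to `σ`). -/
theorem stmt19 (lam mu : Cardinal) (K : Set Cardinal) (hctx : GroundCtx lam mu K)
    (hGCH : ∀ θc : Cardinal, lam ≤ θc → θc ≤ mu → (2 : Cardinal) ^ θc = Order.succ θc) :
    (#↥{q : Cond | inQ lam mu K q} = Cardinal.lift.{1} mu) ∧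
    (2 ^< theta lam K mu ≤ mu) ∧
    (∀ θc : Cardinal, θc < lam → ∀ f : Ordinal → Cond,
      (∀ i < θc.ord, inQ lam mu K (f i)) →
      (∀ i j : Ordinal, i ≤ j → j < θc.ord → condLe lam mu K (f i) (f j)) →
      inQ lam mu K (unionFam f θc.ord) ∧
        ∀ i < θc.ord, condLe lam mu K (f i) (unionFam f θc.ord)) ∧
    (∀ f : Ordinal → Cond,
      (∀ i < (Order.succ (2 ^< theta lam K mu)).ord, inQ lam mu K (f i)) →
      ∃ i j : Ordinal, i < (Order.succ (2 ^< theta lam K mu)).ord ∧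
        j < (Order.succ (2 ^< theta lam K mu)).ord ∧ i ≠ j ∧
        compatQ lam mu K (f i) (f j)) ∧
    (∀ τ σc : Cardinal, τ.IsRegular → σc.IsRegular → lam ≤ τ → τ < σc → σc ≤ mu →
      ∀ q₀ : Cond, inQ lam mu K q₀ →
      ∀ valName : Ordinal → Cond → Ordinal → Prop,
        (∀ α r r' β, valName α r β → inQ lam mu K r' → condLe lam mu K r r' →
          valName α r' β) →
        (∀ α r β β', valName α r β → valName α r β' → β = β') →
        (∀ α r β, valName α r β → β < σc.ord) →
        (∀ α, α < τ.ord → ∀ q, inQ lam mu K q → condLe lam mu K q₀ q →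
          ∃ r, inQ lam mu K r ∧ condLe lam mu K q r ∧ ∃ β, valName α r β) →
        ¬ (∀ γ, γ < σc.ord → ∀ q, inQ lam mu K q → condLe lam mu K q₀ q →
            ∃ r, inQ lam mu K r ∧ condLe lam mu K q r ∧
              ∃ α, α < τ.ord ∧ ∃ β, γ ≤ β ∧ valName α r β)) := by
  refine ⟨claim_card hctx hGCH, claim_pow hctx hGCH, ?_, fun f hf => claim_cc hctx hGCH f hf, ?_⟩
  · intro θc hθ f hQ hle
    refine union_ok hctx hQ hle ?_
    intro κ hκ
    left
    rw [card_ord]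
    exact hθ.trans_le (th_spec hctx hκ).2.1
  · intro τ σc hτ hσ hlτ hτσ hσm q₀ hq₀ valName hv1 hv2 hv3 _ hcof
    exact claim_cof hctx hGCH τ σc hτ hσ hlτ hτσ hσm q₀ hq₀ valName hv1 hv2 hv3 hcof
end
end
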